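/- arXiv:2303.11582 — 4 statements merged into one kernel-verified Lean document; each statement's English description precedes it below -/
import Mathlib

section
/- Let X_1, …, X_n be i.i.d. random vectors in ℝ^K with E[X_1] = 0, covariance matrix Σ, and E‖X_1‖₂⁴ < ∞. Let S_n = n^{−1/2} Σ_{j=1}^{n} X_j, let Z be a standard Gaussian vector in ℝ^K, and let Σ^{1/2} denote the positive semidefinite square root of Σ. Then for every three-times continuously differentiable f : ℝ^K → ℝ with M₂(f) = sup_x ‖∇²f(x)‖_op < ∞ and M₃(f) = sup_x ‖∇³f(x)‖_op < ∞, |E f(S_n) − E f(Σ^{1/2} Z)| ≤ n^{−1/2} · [ (sqrt(K)/4) · M₂(f) · sqrt(E‖X_1‖₂⁴) + (8/9) · M₃(f) · E‖X_1‖₂³ ]. -/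
open MeasureTheory ProbabilityTheory
open scoped ENNReal

section Taylor

variable {E : Type*} [NormedAddCommGroup E] [NormedSpace ℝ E] {f : E → ℝ} {M : ℝ}

/-- The remainder of the second order Taylor expansion of `f` at `s`, in direction `x`. -/
noncomputable def taylorTwoRemainder (f : E → ℝ) (s x : E) : ℝ :=
  f (s + x) - (f s + fderiv ℝ f s x + 2⁻¹ * iteratedFDeriv ℝ 2 f s (fun _ => x))

lemma abs_taylorTwoRemainder_le (hf : ContDiff ℝ 3 f)
    (hM : ∀ x, ‖iteratedFDeriv ℝ 3 f x‖ ≤ M) (s x : E) :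
    |taylorTwoRemainder f s x| ≤ M / 6 * ‖x‖ ^ 3 := by
  have h := map_add_eq_sum_add_integral_iteratedFDeriv (n := 2) (f := f) (x := s) (y := x)
    (fun t _ => by exact_mod_cast hf.contDiffAt)
  have hb : ‖∫ t in (0 : ℝ)..1,
      (1 - t) ^ 2 • iteratedFDeriv ℝ (2 + 1) f (s + t • x) (fun _ => x)‖
      ≤ ∫ t in (0 : ℝ)..1, (1 - t) ^ 2 * (M * ‖x‖ ^ 3) := by
    refine intervalIntegral.norm_integral_le_of_norm_le zero_le_one ?_ ?_
    · refine Filter.Eventually.of_forall fun t _ => ?_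
      rw [norm_smul, Real.norm_of_nonneg (sq_nonneg _)]
      gcongr
      refine (ContinuousMultilinearMap.le_opNorm _ _).trans ?_
      simp only [Finset.prod_const, Finset.card_univ, Fintype.card_fin]
      gcongr
      exact hM _
    · exact Continuous.intervalIntegrable (by fun_prop) _ _
  have hi : ∫ t in (0 : ℝ)..1, (1 - t) ^ 2 * (M * ‖x‖ ^ 3) = M * ‖x‖ ^ 3 / 3 := by
    rw [intervalIntegral.integral_mul_const,
      intervalIntegral.integral_comp_sub_left (fun t : ℝ => t ^ 2) 1]
    norm_num
    ring
  rw [hi] at hb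
  have hr : taylorTwoRemainder f s x = 2⁻¹ * ∫ t in (0 : ℝ)..1,
      (1 - t) ^ 2 • iteratedFDeriv ℝ (2 + 1) f (s + t • x) (fun _ => x) := by
    rw [taylorTwoRemainder, h]
    simp [Finset.sum_range_succ]
  rw [hr, abs_mul, abs_of_pos (by norm_num : (0 : ℝ) < 2⁻¹), ← Real.norm_eq_abs]
  linarith

end Taylor

section Conv

variable {E : Type*} [NormedAddCommGroup E] [MeasurableSpace E] {μ γ ν : Measure E}

lemma MeasureTheory.MemLp.integrable_norm_id_pow [IsFiniteMeasure μ] (hμ : MemLp id 3 μ) {k : ℕ}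
    (hk : k ≤ 3) : Integrable (fun x => ‖x‖ ^ k) μ :=
  (hμ.mono_exponent (by exact_mod_cast hk : (k : ℝ≥0∞) ≤ 3)).integrable_norm_pow'

variable [BorelSpace E] [SecondCountableTopology E]

lemma MeasureTheory.MemLp.id_conv {p : ℝ≥0∞} [IsProbabilityMeasure μ] [IsProbabilityMeasure ν]
    (hμ : MemLp id p μ) (hν : MemLp id p ν) : MemLp id p (μ ∗ ν) := by
  rw [Measure.conv, memLp_map_measure_iff (by fun_prop) (by fun_prop)]
  exact (hμ.comp_fst ν).add (hν.comp_snd μ)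

lemma isProbabilityMeasure_iterate_conv [IsProbabilityMeasure μ] [IsProbabilityMeasure ν] (k : ℕ) :
    IsProbabilityMeasure ((μ ∗ ·)^[k] ν) := by
  induction k with
  | zero => simpa
  | succ k ih => rw [Function.iterate_succ_apply']; infer_instance

lemma memLp_id_iterate_conv {p : ℝ≥0∞} [IsProbabilityMeasure μ] [IsProbabilityMeasure ν]
    (hμ : MemLp id p μ) (hν : MemLp id p ν) (k : ℕ) : MemLp id p ((μ ∗ ·)^[k] ν) := by
  induction k with
  | zero => simpa
  | succ k ih =>
    rw [Function.iterate_succ_apply']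
    have := isProbabilityMeasure_iterate_conv (μ := μ) (ν := ν) k
    exact hμ.id_conv ih

lemma iterate_conv_conv [IsProbabilityMeasure μ] [IsProbabilityMeasure γ] [IsProbabilityMeasure ν]
    (k : ℕ) : (γ ∗ ·)^[k] (μ ∗ ν) = μ ∗ (γ ∗ ·)^[k] ν := by
  induction k with
  | zero => rfl
  | succ k ih =>
    have := isProbabilityMeasure_iterate_conv (μ := γ) (ν := ν) k
    rw [Function.iterate_succ_apply', Function.iterate_succ_apply', ih, ← Measure.conv_assoc,
      ← Measure.conv_assoc, Measure.conv_comm γ μ]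

end Conv

section Lindeberg

variable {E : Type*} [NormedAddCommGroup E] [NormedSpace ℝ E] [MeasurableSpace E]
  {f : E → ℝ} {M : ℝ} {μ γ ν : Measure E}

lemma abs_integral_taylorTwoRemainder_le [IsFiniteMeasure μ] (hf : ContDiff ℝ 3 f)
    (hM : ∀ x, ‖iteratedFDeriv ℝ 3 f x‖ ≤ M) (hμ : MemLp id 3 μ) (s : E) :
    |∫ x, taylorTwoRemainder f s x ∂μ| ≤ M / 6 * ∫ x, ‖x‖ ^ 3 ∂μ := by
  rw [← integral_const_mul, ← Real.norm_eq_abs]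
  exact norm_integral_le_of_norm_le ((hμ.integrable_norm_id_pow le_rfl).const_mul _)
    (Filter.Eventually.of_forall fun x => abs_taylorTwoRemainder_le hf hM s x)

variable [BorelSpace E]

lemma integrable_continuousMultilinearMap_diag [IsFiniteMeasure μ] (hμ : MemLp id 3 μ)
    (B : ContinuousMultilinearMap ℝ (fun _ : Fin 2 => E) ℝ) :
    Integrable (fun x => B (fun _ => x)) μ := by
  refine ((hμ.integrable_norm_id_pow (k := 2) (by norm_num)).const_mul ‖B‖).mono'
    (Continuous.aestronglyMeasurable (by fun_prop)) ?_
  refine Filter.Eventually.of_forall fun x => ?_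
  simpa using B.le_opNorm (fun _ => x)

lemma integrable_taylorTwoRemainder [IsFiniteMeasure μ] (hf : ContDiff ℝ 3 f)
    (hM : ∀ x, ‖iteratedFDeriv ℝ 3 f x‖ ≤ M) (hμ : MemLp id 3 μ) (s : E) :
    Integrable (taylorTwoRemainder f s) μ := by
  refine ((hμ.integrable_norm_id_pow le_rfl).const_mul (M / 6)).mono' ?_ ?_
  · have := hf.continuous
    exact Continuous.aestronglyMeasurable (by unfold taylorTwoRemainder; fun_prop)
  · exact Filter.Eventually.of_forall fun x => abs_taylorTwoRemainder_le hf hM s x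

lemma integrable_taylorTwo [IsFiniteMeasure μ] (hμ : MemLp id 3 μ) (s : E) :
    Integrable (fun x => f s + fderiv ℝ f s x + 2⁻¹ * iteratedFDeriv ℝ 2 f s (fun _ => x)) μ :=
  ((integrable_const _).add ((fderiv ℝ f s).integrable_comp
    (hμ.integrable (by norm_num)))).add
    ((integrable_continuousMultilinearMap_diag hμ _).const_mul _)

lemma integrable_comp_const_add [IsFiniteMeasure μ] (hf : ContDiff ℝ 3 f)
    (hM : ∀ x, ‖iteratedFDeriv ℝ 3 f x‖ ≤ M) (hμ : MemLp id 3 μ) (s : E) :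
    Integrable (fun x => f (s + x)) μ := by
  refine ((integrable_taylorTwoRemainder hf hM hμ s).add (integrable_taylorTwo (f := f) hμ s)).congr
    (Filter.Eventually.of_forall fun x => ?_)
  simp [taylorTwoRemainder]

lemma integral_comp_const_add_eq [CompleteSpace E] [IsProbabilityMeasure μ] (hf : ContDiff ℝ 3 f)
    (hM : ∀ x, ‖iteratedFDeriv ℝ 3 f x‖ ≤ M) (hμ : MemLp id 3 μ) (s : E) :
    ∫ x, f (s + x) ∂μ = ∫ x, taylorTwoRemainder f s x ∂μ + (f s + fderiv ℝ f s (∫ x, x ∂μ)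
      + 2⁻¹ * ∫ x, iteratedFDeriv ℝ 2 f s (fun _ => x) ∂μ) := by
  have hid : Integrable (fun x => x) μ := hμ.integrable (by norm_num)
  have h1 := (fderiv ℝ f s).integrable_comp hid
  have h2 := (integrable_continuousMultilinearMap_diag hμ (iteratedFDeriv ℝ 2 f s)).const_mul 2⁻¹
  rw [← ContinuousLinearMap.integral_comp_comm _ hid, ← integral_const_mul]
  have hc : f s = ∫ _, f s ∂μ := by simp
  conv_rhs => rw [hc]
  rw [← integral_add (integrable_const _) h1, ← integral_add _ h2,
    ← integral_add (integrable_taylorTwoRemainder hf hM hμ s) (integrable_taylorTwo hμ s)]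
  · simp [taylorTwoRemainder]
  · exact (integrable_const _).add h1

variable [SecondCountableTopology E]

/-- One replacement step of Lindeberg's method. -/
lemma abs_integral_conv_sub_integral_conv_le [CompleteSpace E]
    [IsProbabilityMeasure μ] [IsProbabilityMeasure γ]
    [IsProbabilityMeasure ν] (hf : ContDiff ℝ 3 f) (hM : ∀ x, ‖iteratedFDeriv ℝ 3 f x‖ ≤ M)
    (hμ : MemLp id 3 μ) (hγ : MemLp id 3 γ) (hν : MemLp id 3 ν)
    (h1 : ∫ x, x ∂μ = ∫ x, x ∂γ)
    (h2 : ∀ B : ContinuousMultilinearMap ℝ (fun _ : Fin 2 => E) ℝ,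
      ∫ x, B (fun _ => x) ∂μ = ∫ x, B (fun _ => x) ∂γ) :
    |∫ x, f x ∂(μ ∗ ν) - ∫ x, f x ∂(γ ∗ ν)|
      ≤ M / 6 * (∫ x, ‖x‖ ^ 3 ∂μ + ∫ x, ‖x‖ ^ 3 ∂γ) := by
  have hint {ρ : Measure E} [IsProbabilityMeasure ρ] (hρ : MemLp id 3 ρ) :
      Integrable f (ν ∗ ρ) := by
    simpa using integrable_comp_const_add hf hM (hν.id_conv hρ) 0
  have hint' {ρ : Measure E} [IsProbabilityMeasure ρ] (hρ : MemLp id 3 ρ) :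
      Integrable (fun s => ∫ x, f (s + x) ∂ρ) ν := by
    have := hint hρ
    rw [Measure.conv, integrable_map_measure (hf.continuous.aestronglyMeasurable)
      (by fun_prop)] at this
    exact this.integral_prod_left
  rw [Measure.conv_comm μ, Measure.conv_comm γ, integral_conv (hint hμ), integral_conv (hint hγ),
    ← integral_sub (hint' hμ) (hint' hγ), ← Real.norm_eq_abs]
  refine (norm_integral_le_of_norm_le_const
    (C := M / 6 * (∫ x, ‖x‖ ^ 3 ∂μ + ∫ x, ‖x‖ ^ 3 ∂γ))
    (Filter.Eventually.of_forall fun s => ?_)).trans (by simp)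
  rw [integral_comp_const_add_eq hf hM hμ, integral_comp_const_add_eq hf hM hγ, h1, h2,
    add_sub_add_right_eq_sub, mul_add, Real.norm_eq_abs]
  exact (abs_sub _ _).trans (add_le_add (abs_integral_taylorTwoRemainder_le hf hM hμ s)
    (abs_integral_taylorTwoRemainder_le hf hM hγ s))

lemma abs_integral_iterate_conv_sub_le [CompleteSpace E]
    [IsProbabilityMeasure μ] [IsProbabilityMeasure γ]
    [IsProbabilityMeasure ν] (hf : ContDiff ℝ 3 f) (hM : ∀ x, ‖iteratedFDeriv ℝ 3 f x‖ ≤ M)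
    (hμ : MemLp id 3 μ) (hγ : MemLp id 3 γ) (hν : MemLp id 3 ν)
    (h1 : ∫ x, x ∂μ = ∫ x, x ∂γ)
    (h2 : ∀ B : ContinuousMultilinearMap ℝ (fun _ : Fin 2 => E) ℝ,
      ∫ x, B (fun _ => x) ∂μ = ∫ x, B (fun _ => x) ∂γ) (k : ℕ) :
    |∫ x, f x ∂((μ ∗ ·)^[k] ν) - ∫ x, f x ∂((γ ∗ ·)^[k] ν)|
      ≤ k * (M / 6 * (∫ x, ‖x‖ ^ 3 ∂μ + ∫ x, ‖x‖ ^ 3 ∂γ)) := by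
  induction k generalizing ν with
  | zero => simp
  | succ k ih =>
    have := isProbabilityMeasure_iterate_conv (μ := γ) (ν := ν) k
    have hstep := abs_integral_conv_sub_integral_conv_le hf hM hμ hγ
      (memLp_id_iterate_conv hγ hν k) h1 h2
    have hind := ih (hμ.id_conv hν)
    rw [iterate_conv_conv (μ := μ) (γ := γ)] at hind
    rw [Function.iterate_succ_apply, Function.iterate_succ_apply' (γ ∗ ·)]
    refine (abs_sub_le _ _ _).trans ((add_le_add hind hstep).trans (le_of_eq ?_))
    push_cast
    ring

end Lindeberg

section GaussianMoments

open scoped NNReal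

lemma iteratedDeriv_four_exp_mul_sq (a : ℝ) :
    iteratedDeriv 4 (fun t : ℝ => Real.exp (a * t ^ 2 / 2)) 0 = 3 * a ^ 2 := by
  have he (t : ℝ) : HasDerivAt (fun t : ℝ => Real.exp (a * t ^ 2 / 2))
      (Real.exp (a * t ^ 2 / 2) * (a * t)) t := by
    convert (((hasDerivAt_pow 2 t).const_mul a).div_const 2).exp using 1
    norm_num
    ring
  have hmul {p p' : ℝ → ℝ} (hp : ∀ t, HasDerivAt p (p' t) t) :
      deriv (fun t => p t * Real.exp (a * t ^ 2 / 2))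
        = fun t => (p' t + p t * (a * t)) * Real.exp (a * t ^ 2 / 2) := by
    funext t
    exact (((hp t).mul (he t)).congr_deriv (by ring)).deriv
  have h1 : deriv (fun t : ℝ => Real.exp (a * t ^ 2 / 2))
      = fun t => (a * t) * Real.exp (a * t ^ 2 / 2) := by
    funext t
    rw [(he t).deriv, mul_comm]
  have hlin (c t : ℝ) : HasDerivAt (fun t : ℝ => c * t) c t := by
    simpa using (hasDerivAt_id t).const_mul c
  have hquad (t : ℝ) : HasDerivAt (fun t : ℝ => a + a * t * (a * t)) (2 * a ^ 2 * t) t :=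
    (((hlin a t).mul (hlin a t)).const_add a).congr_deriv (by ring)
  have hcubic (t : ℝ) : HasDerivAt
      (fun t : ℝ => 2 * a ^ 2 * t + (a + a * t * (a * t)) * (a * t))
      (3 * a ^ 2 + 3 * a ^ 3 * t ^ 2) t :=
    ((hlin (2 * a ^ 2) t).add ((hquad t).mul (hlin a t))).congr_deriv (by ring)
  have h2 := hmul (hlin a)
  have h3 := hmul hquad
  have h4 := hmul hcubic
  rw [iteratedDeriv_eq_iterate]
  simp only [Function.iterate_succ, Function.iterate_zero, Function.comp_apply, id]
  rw [h1, h2, h3, h4]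
  norm_num

lemma integral_pow_four_gaussianReal (v : ℝ≥0) :
    ∫ x, x ^ 4 ∂(gaussianReal 0 v) = 3 * (v : ℝ) ^ 2 := by
  have h := iteratedDeriv_mgf_zero (X := id) (μ := gaussianReal 0 v)
    (by simp [integrableExpSet_id_gaussianReal]) 4
  rw [mgf_id_gaussianReal] at h
  simp only [zero_mul, zero_add, iteratedDeriv_four_exp_mul_sq] at h
  rw [h]
  simp

variable {ι : Type*} [Fintype ι] [DecidableEq ι] {S : Matrix ι ι ℝ}

lemma integral_mul_eval_multivariateGaussian (hS : S.PosSemidef) (i j : ι) :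
    ∫ x, x i * x j ∂(multivariateGaussian 0 S) = S i j := by
  have h0 (i : ι) : ∫ x, x i ∂(multivariateGaussian 0 S) = 0 := by
    have := (EuclideanSpace.proj i : EuclideanSpace ℝ ι →L[ℝ] ℝ).integral_comp_comm
      (IsGaussian.integrable_id (μ := multivariateGaussian 0 S))
    simpa using this
  have hL (i : ι) : MemLp (fun x : EuclideanSpace ℝ ι => x i) 2 (multivariateGaussian 0 S) :=
    (EuclideanSpace.proj i : EuclideanSpace ℝ ι →L[ℝ] ℝ).comp_memLp'
      IsGaussian.memLp_two_id
  rw [← covariance_eval_multivariateGaussian (μ := 0) hS i j, covariance_eq_sub (hL i) (hL j)]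
  simp [h0]

lemma integral_eval_pow_four_multivariateGaussian (hS : S.PosSemidef) (i : ι) :
    ∫ x, x i ^ 4 ∂(multivariateGaussian 0 S) = 3 * S i i ^ 2 := by
  have h := measurePreserving_eval_multivariateGaussian (μ := 0) hS (i := i)
  have h' := integral_map (μ := multivariateGaussian 0 S) h.measurable.aemeasurable
    (f := fun y : ℝ => y ^ 4) (by fun_prop)
  rw [← h', h.map_eq]
  simp only [PiLp.zero_apply]
  rw [integral_pow_four_gaussianReal, Real.coe_toNNReal _ hS.diag_nonneg]

lemma memLp_id_multivariateGaussian (p : ℝ≥0) :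
    MemLp id p (multivariateGaussian (0 : EuclideanSpace ℝ ι) S) :=
  IsGaussian.memLp_id _ _ (by simp)

lemma integrable_eval_pow_multivariateGaussian (i : ι) (n : ℕ) :
    Integrable (fun x => x i ^ n) (multivariateGaussian (0 : EuclideanSpace ℝ ι) S) := by
  have h := (memLp_id_multivariateGaussian (S := S) n).integrable_norm_pow'
  refine h.mono' (by fun_prop) (Filter.Eventually.of_forall fun x => ?_)
  rw [norm_pow]
  exact pow_le_pow_left₀ (norm_nonneg _) (PiLp.norm_apply_le x i) n

lemma integral_norm_sq_multivariateGaussian (hS : S.PosSemidef) :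
    ∫ x, ‖x‖ ^ 2 ∂(multivariateGaussian 0 S) = S.trace := by
  simp_rw [EuclideanSpace.real_norm_sq_eq]
  rw [integral_finsetSum _ fun i _ => integrable_eval_pow_multivariateGaussian i 2]
  simp_rw [sq, integral_mul_eval_multivariateGaussian hS]
  rfl

lemma integral_norm_pow_four_multivariateGaussian_le (hS : S.PosSemidef) :
    ∫ x, ‖x‖ ^ 4 ∂(multivariateGaussian 0 S) ≤ 3 * S.trace ^ 2 := by
  have hint (i j : ι) : Integrable (fun x => x i ^ 2 * x j ^ 2)
      (multivariateGaussian (0 : EuclideanSpace ℝ ι) S) := by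
    refine ((integrable_eval_pow_multivariateGaussian i 4).add
      (integrable_eval_pow_multivariateGaussian j 4)).mono' (by fun_prop)
      (Filter.Eventually.of_forall fun x => ?_)
    rw [Real.norm_of_nonneg (by positivity)]
    simp only [Pi.add_apply]
    nlinarith [sq_nonneg (x i ^ 2 - x j ^ 2), sq_nonneg (x i ^ 2), sq_nonneg (x j ^ 2)]
  have hpair (i j : ι) : ∫ x, x i ^ 2 * x j ^ 2 ∂(multivariateGaussian 0 S)
      ≤ 3 * (S i i * S j j) := by
    have hi := hS.diag_nonneg (i := i)
    have hj := hS.diag_nonneg (i := j)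
    have hkey (a b : ℝ) : a * b * 2 * ∫ x, x i ^ 2 * x j ^ 2 ∂(multivariateGaussian 0 S)
        ≤ a ^ 2 * (3 * S i i ^ 2) + b ^ 2 * (3 * S j j ^ 2) := by
      rw [← integral_eval_pow_four_multivariateGaussian hS i,
        ← integral_eval_pow_four_multivariateGaussian hS j, ← integral_const_mul,
        ← integral_const_mul, ← integral_const_mul, ← integral_add
        ((integrable_eval_pow_multivariateGaussian i 4).const_mul _)
        ((integrable_eval_pow_multivariateGaussian j 4).const_mul _)]
      refine integral_mono ((hint i j).const_mul _)
        (((integrable_eval_pow_multivariateGaussian i 4).const_mul _).add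
        ((integrable_eval_pow_multivariateGaussian j 4).const_mul _)) fun x => ?_
      simp only
      nlinarith [sq_nonneg (a * x i ^ 2 - b * x j ^ 2)]
    have hzero {u w : ι} (h : S u u = 0) :
        ∫ x, x u ^ 2 * x w ^ 2 ∂(multivariateGaussian 0 S) = 0 := by
      have h4 : (fun x : EuclideanSpace ℝ ι => x u ^ 4) =ᵐ[multivariateGaussian 0 S] 0 :=
        (integral_eq_zero_iff_of_nonneg (fun x => by simp only [Pi.zero_apply]; positivity)
          (integrable_eval_pow_multivariateGaussian u 4)).1 (by
            rw [integral_eval_pow_four_multivariateGaussian hS, h]; simp)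
      refine integral_eq_zero_of_ae (h4.mono fun x hx => ?_)
      have : x u = 0 := by simpa using hx
      simp [this]
    rcases hi.eq_or_lt with h | h
    · rw [hzero h.symm, ← h]; simp
    rcases hj.eq_or_lt with h' | h'
    · simp_rw [fun x : EuclideanSpace ℝ ι => mul_comm (x i ^ 2) (x j ^ 2)]
      rw [hzero h'.symm, ← h']; simp
    have := hkey (S j j) (S i i)
    refine le_of_mul_le_mul_left (a := 2 * (S i i * S j j)) ?_ (by positivity)
    linarith
  have hexp (x : EuclideanSpace ℝ ι) : ‖x‖ ^ 4 = ∑ i, ∑ j, x i ^ 2 * x j ^ 2 := by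
    rw [← Finset.sum_mul_sum, ← EuclideanSpace.real_norm_sq_eq]
    ring
  simp_rw [hexp]
  rw [integral_finsetSum _ fun i _ => integrable_finsetSum _ fun j _ => hint i j]
  simp_rw [integral_finsetSum _ fun j _ => hint _ j]
  refine (Finset.sum_le_sum fun i _ => Finset.sum_le_sum fun j _ => hpair i j).trans (le_of_eq ?_)
  simp_rw [← Finset.mul_sum]
  rw [← Finset.sum_mul, sq]
  rfl

lemma integral_norm_pow_three_multivariateGaussian_le (hS : S.PosSemidef) :
    ∫ x, ‖x‖ ^ 3 ∂(multivariateGaussian 0 S) ≤ 7 / 4 * Real.sqrt S.trace ^ 3 := by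
  have hint (n : ℕ) : Integrable (fun x => ‖x‖ ^ n)
      (multivariateGaussian (0 : EuclideanSpace ℝ ι) S) :=
    (memLp_id_multivariateGaussian (S := S) n).integrable_norm_pow'
  have h2 := integral_norm_sq_multivariateGaussian hS
  have h4 := integral_norm_pow_four_multivariateGaussian_le hS
  have hsq := Real.sq_sqrt hS.trace_nonneg
  set s := Real.sqrt S.trace
  rcases (Real.sqrt_nonneg S.trace).eq_or_lt with h | h
  · have hs : S.trace = 0 := by rw [← hsq]; simp [s, ← h]
    rw [hs] at h2
    have h0 := (integral_eq_zero_iff_of_nonneg (fun x => by simp only [Pi.zero_apply]; positivity)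
          (hint 2)).1 h2
    rw [integral_eq_zero_of_ae (h0.mono fun x hx => ?_)]
    · positivity
    · have : x = 0 := by simpa using hx
      simp [this]
  · have hkey : 4 * s * ∫ x, ‖x‖ ^ 3 ∂(multivariateGaussian 0 S)
        ≤ ∫ x, ‖x‖ ^ 4 ∂(multivariateGaussian 0 S)
          + 4 * s ^ 2 * ∫ x, ‖x‖ ^ 2 ∂(multivariateGaussian 0 S) := by
      rw [← integral_const_mul, ← integral_const_mul,
        ← integral_add (hint 4) ((hint 2).const_mul _)]
      refine integral_mono ((hint 3).const_mul _) ((hint 4).add ((hint 2).const_mul _)) fun x => ?_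
      simp only
      nlinarith [sq_nonneg (‖x‖ * (‖x‖ - 2 * s))]
    rw [h2, ← hsq] at hkey
    rw [← hsq] at h4
    refine le_of_mul_le_mul_left (a := 4 * s) ?_ (by positivity)
    linarith

end GaussianMoments

/-- Lyapunov's inequality between the second and third absolute moments. -/
lemma sqrt_integral_norm_sq_pow_three_le {E : Type*} [NormedAddCommGroup E] [MeasurableSpace E]
    {μ : Measure E} [IsProbabilityMeasure μ] (h2 : Integrable (fun x => ‖x‖ ^ 2) μ)
    (h3 : Integrable (fun x => ‖x‖ ^ 3) μ) :
    Real.sqrt (∫ x, ‖x‖ ^ 2 ∂μ) ^ 3 ≤ ∫ x, ‖x‖ ^ 3 ∂μ := by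
  have hsq := Real.sq_sqrt (integral_nonneg (μ := μ) fun x => sq_nonneg ‖x‖)
  have hs := Real.sqrt_nonneg (∫ x, ‖x‖ ^ 2 ∂μ)
  set s := Real.sqrt (∫ x, ‖x‖ ^ 2 ∂μ)
  have hkey : ∫ x, 3 / 2 * s * ‖x‖ ^ 2 ∂μ ≤ ∫ x, ‖x‖ ^ 3 + s ^ 3 / 2 ∂μ :=
    integral_mono (h2.const_mul _) (h3.add (integrable_const _)) fun x => by
      nlinarith [mul_nonneg (sq_nonneg (‖x‖ - s)) (norm_nonneg x),
        mul_nonneg (sq_nonneg (‖x‖ - s)) hs]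
  rw [integral_const_mul, integral_add h3 (integrable_const _), ← hsq] at hkey
  simp at hkey
  nlinarith

section

variable {E : Type*} [NormedAddCommGroup E] [InnerProductSpace ℝ E] [MeasurableSpace E]
  [BorelSpace E] [SecondCountableTopology E] {μ ν : Measure E}

lemma charFun_iterate_conv [IsProbabilityMeasure μ] [IsProbabilityMeasure ν] (k : ℕ) (t : E) :
    charFun ((μ ∗ ·)^[k] ν) t = charFun μ t ^ k * charFun ν t := by
  induction k with
  | zero => simp
  | succ k ih =>
    have := isProbabilityMeasure_iterate_conv (μ := μ) (ν := ν) k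
    rw [Function.iterate_succ_apply', charFun_conv, ih]
    ring

end

section Laws

variable {E : Type*} [NormedAddCommGroup E] [InnerProductSpace ℝ E] [CompleteSpace E]
  [MeasurableSpace E] [BorelSpace E] [SecondCountableTopology E] {μ ν : Measure E}

lemma map_smul_sum_pi_eq_iterate_conv [IsProbabilityMeasure μ] (n : ℕ) (c : ℝ) :
    (Measure.pi fun _ : Fin n => μ).map (fun x => c • ∑ j, x j)
      = ((μ.map (c • ·)) ∗ ·)^[n] (Measure.dirac 0) := by
  have : IsProbabilityMeasure (μ.map (c • ·)) := Measure.isProbabilityMeasure_map (by fun_prop)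
  have := isProbabilityMeasure_iterate_conv (μ := μ.map (c • ·)) (ν := Measure.dirac 0) n
  have : IsProbabilityMeasure ((Measure.pi fun _ : Fin n => μ).map (fun x => c • ∑ j, x j)) :=
    Measure.isProbabilityMeasure_map (by fun_prop)
  refine Measure.ext_of_charFun ?_
  funext t
  rw [charFun_iterate_conv, charFun_map_smul_comp (by fun_prop), charFun_map_sum_pi_eq_prod,
    charFun_map_smul]
  simp

lemma multivariateGaussian_eq_iterate_conv {ι : Type*} [Fintype ι] [DecidableEq ι]
    {S : Matrix ι ι ℝ} (hS : S.PosSemidef) {n : ℕ} {c : ℝ} (hc : n * c ^ 2 = 1) :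
    multivariateGaussian 0 S
      = (((multivariateGaussian 0 S).map (c • ·)) ∗ ·)^[n] (Measure.dirac 0) := by
  have : IsProbabilityMeasure ((multivariateGaussian 0 S).map (c • ·)) :=
    Measure.isProbabilityMeasure_map (by fun_prop)
  have := isProbabilityMeasure_iterate_conv (μ := (multivariateGaussian 0 S).map (c • ·))
    (ν := Measure.dirac 0) n
  refine Measure.ext_of_charFun ?_
  funext t
  rw [charFun_iterate_conv, charFun_map_smul, charFun_multivariateGaussian hS,
    charFun_multivariateGaussian hS, ← Complex.exp_nat_mul]
  have hc' : (n : ℂ) * (c : ℂ) ^ 2 = 1 := by exact_mod_cast hc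
  simp [Matrix.mulVec_smul]
  congr 1
  linear_combination (-(t.ofLp ⬝ᵥ S.mulVec t.ofLp : ℝ) / 2 : ℂ) * (-hc')

open scoped MatrixOrder Matrix.Norms.L2Operator in
lemma map_pi_mulVec_eq_multivariateGaussian {ι : Type*} [Fintype ι] [DecidableEq ι]
    {Q : Matrix ι ι ℝ} (hQ : Q.PosSemidef) :
    (Measure.pi fun _ : ι => gaussianReal 0 1).map
      (fun z => (WithLp.equiv 2 (ι → ℝ)).symm (Q.mulVec z)) = multivariateGaussian 0 (Q * Q) := by
  rw [multivariateGaussian, CFC.sqrt_mul_self Q hQ.nonneg, ← map_pi_eq_stdGaussian,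
    Measure.map_map (by fun_prop) (by fun_prop)]
  congr 1
  funext z
  simp

end Laws

lemma integral_continuousMultilinearMap_diag_eq {ι : Type*} [Fintype ι]
    {μ γ : Measure (EuclideanSpace ℝ ι)}
    (hμ : ∀ i j, Integrable (fun x => x i * x j) μ)
    (hγ : ∀ i j, Integrable (fun x => x i * x j) γ)
    (h : ∀ i j, ∫ x, x i * x j ∂μ = ∫ x, x i * x j ∂γ)
    (B : ContinuousMultilinearMap ℝ (fun _ : Fin 2 => EuclideanSpace ℝ ι) ℝ) :
    ∫ x, B (fun _ => x) ∂μ = ∫ x, B (fun _ => x) ∂γ := by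
  classical
  have hB (x : EuclideanSpace ℝ ι) : B (fun _ => x) = ∑ r : Fin 2 → ι,
      (x (r 0) * x (r 1)) * B (fun k => EuclideanSpace.basisFun ι ℝ (r k)) := by
    conv_lhs => rw [← (EuclideanSpace.basisFun ι ℝ).sum_repr x]
    rw [B.map_sum]
    refine Finset.sum_congr rfl fun r _ => ?_
    rw [B.map_smul_univ]
    simp
  simp_rw [hB]
  rw [integral_finsetSum _ fun r _ => (hμ (r 0) (r 1)).mul_const _,
    integral_finsetSum _ fun r _ => (hγ (r 0) (r 1)).mul_const _]
  simp_rw [integral_mul_const, h]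

lemma memLp_three_of_integrable_norm_pow_four {E : Type*} [NormedAddCommGroup E]
    [MeasurableSpace E] [BorelSpace E] [SecondCountableTopology E] {μ : Measure E}
    [IsFiniteMeasure μ] (h : Integrable (fun x => ‖x‖ ^ 4) μ) : MemLp id 3 μ := by
  have h4 : MemLp id 4 μ :=
    (integrable_norm_rpow_iff (by fun_prop) (by norm_num) (by norm_num)).1 (by simpa using h)
  exact h4.mono_exponent (by norm_num)

/-- Stein's-method normal approximation bound: if `X_1, …, X_n` are
i.i.d. mean-zero random vectors in `ℝ^K` with covariance `Σ` and finite fourth moment,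
`S_n = n^{−1/2} Σ_j X_j`, and `Σ^{1/2}` is the positive semidefinite square root of `Σ`,
then for every `C³` function `f` with bounded second and third derivatives,
`|E f(S_n) − E f(Σ^{1/2} Z)| ≤ n^{−1/2} [ (√K/4) M₂ √(E‖X‖₂⁴) + (8/9) M₃ E‖X‖₂³ ]`.
The i.i.d. sample is encoded through its product law `⊗_{j=1}^n μX`. -/
theorem stmt15 (K : ℕ) (hK : 0 < K)
    (μX : Measure (EuclideanSpace ℝ (Fin K))) [IsProbabilityMeasure μX]
    (hmom : Integrable (fun x => ‖x‖ ^ 4) μX)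
    (hmean : (∫ x, x ∂μX) = 0)
    (Scov : Matrix (Fin K) (Fin K) ℝ)
    (hScov : ∀ i j, Scov i j = ∫ x, x i * x j ∂μX)
    (Q : Matrix (Fin K) (Fin K) ℝ) (hQ : Q.PosSemidef) (hQsq : Q * Q = Scov)
    (n : ℕ) (hn : 1 ≤ n)
    (f : EuclideanSpace ℝ (Fin K) → ℝ) (hf : ContDiff ℝ 3 f)
    (M₂ M₃ : ℝ)
    (hM₂ : ∀ x, ‖iteratedFDeriv ℝ 2 f x‖ ≤ M₂)
    (hM₃ : ∀ x, ‖iteratedFDeriv ℝ 3 f x‖ ≤ M₃) :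
    |(∫ x : Fin n → EuclideanSpace ℝ (Fin K),
          f ((Real.sqrt n)⁻¹ • ∑ j, x j) ∂(Measure.pi fun _ => μX))
        - ∫ z : Fin K → ℝ, f ((WithLp.equiv 2 (Fin K → ℝ)).symm (Q.mulVec z))
            ∂(Measure.pi fun _ => gaussianReal 0 1)|
      ≤ (Real.sqrt n)⁻¹ *
          (Real.sqrt K / 4 * M₂ * Real.sqrt (∫ x, ‖x‖ ^ 4 ∂μX)
            + 8 / 9 * M₃ * ∫ x, ‖x‖ ^ 3 ∂μX) := by
  have hsqrt : 0 < Real.sqrt n := Real.sqrt_pos.2 (by exact_mod_cast hn)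
  set c : ℝ := (Real.sqrt n)⁻¹ with hc
  have hc0 : 0 < c := inv_pos.2 hsqrt
  have hnc : n * c ^ 2 = 1 := by
    rw [hc, inv_pow, Real.sq_sqrt (Nat.cast_nonneg n)]
    exact mul_inv_cancel₀ (by positivity)
  have hS : Scov.PosSemidef := by
    have := Matrix.posSemidef_conjTranspose_mul_self Q
    rwa [hQ.1.eq, hQsq] at this
  have hμ := memLp_three_of_integrable_norm_pow_four hmom
  set γ := multivariateGaussian 0 Scov with hγdef
  have hγ : MemLp id 3 γ := memLp_id_multivariateGaussian 3
  have hprod {ρ : Measure (EuclideanSpace ℝ (Fin K))} [IsProbabilityMeasure ρ]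
      (hρ : MemLp id 3 ρ) (i j : Fin K) : Integrable (fun x => x i * x j) ρ := by
    refine (hρ.integrable_norm_id_pow (k := 2) (by norm_num)).mono' (by fun_prop)
      (Filter.Eventually.of_forall fun x => ?_)
    rw [norm_mul, sq]
    exact mul_le_mul (PiLp.norm_apply_le x i) (PiLp.norm_apply_le x j) (norm_nonneg _)
      (norm_nonneg _)
  have hB (B : ContinuousMultilinearMap ℝ (fun _ : Fin 2 => EuclideanSpace ℝ (Fin K)) ℝ) :
      ∫ x, B (fun _ => x) ∂μX = ∫ x, B (fun _ => x) ∂γ :=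
    integral_continuousMultilinearMap_diag_eq (hprod hμ) (hprod hγ) (fun i j => by
      rw [integral_mul_eval_multivariateGaussian hS, hScov]) B
  have htrace : ∫ x, ‖x‖ ^ 2 ∂μX = Scov.trace := by
    simp_rw [EuclideanSpace.real_norm_sq_eq, sq]
    rw [integral_finsetSum _ fun i _ => hprod hμ i i]
    simp [Matrix.trace, hScov]
  have hγ3 : ∫ x, ‖x‖ ^ 3 ∂γ ≤ 7 / 4 * ∫ x, ‖x‖ ^ 3 ∂μX := by
    refine (integral_norm_pow_three_multivariateGaussian_le hS).trans ?_
    rw [← htrace]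
    gcongr
    exact sqrt_integral_norm_sq_pow_three_le (hμ.integrable_norm_id_pow (by norm_num))
      (hμ.integrable_norm_id_pow le_rfl)
  have hscaled {ρ : Measure (EuclideanSpace ℝ (Fin K))} (hρ : MemLp id 3 ρ) :
      MemLp id 3 (ρ.map (c • ·)) := by
    rw [memLp_map_measure_iff (by fun_prop) (by fun_prop)]
    exact hρ.const_smul c
  have hscaled_norm (ρ : Measure (EuclideanSpace ℝ (Fin K))) :
      ∫ x, ‖x‖ ^ 3 ∂(ρ.map (c • ·)) = c ^ 3 * ∫ x, ‖x‖ ^ 3 ∂ρ := by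
    rw [integral_map (by fun_prop) (by fun_prop), ← integral_const_mul]
    simp_rw [norm_smul, mul_pow, Real.norm_of_nonneg hc0.le]
  have hscaled_diag (ρ : Measure (EuclideanSpace ℝ (Fin K)))
      (B : ContinuousMultilinearMap ℝ (fun _ : Fin 2 => EuclideanSpace ℝ (Fin K)) ℝ) :
      ∫ x, B (fun _ => x) ∂(ρ.map (c • ·)) = c ^ 2 * ∫ x, B (fun _ => x) ∂ρ := by
    rw [integral_map (by fun_prop) (Continuous.aestronglyMeasurable (by fun_prop)),
      ← integral_const_mul]
    congr with x
    simpa using B.map_smul_univ (fun _ => c) (fun _ => x)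
  have : IsProbabilityMeasure (μX.map (c • ·)) := Measure.isProbabilityMeasure_map (by fun_prop)
  have : IsProbabilityMeasure (γ.map (c • ·)) := Measure.isProbabilityMeasure_map (by fun_prop)
  have hdirac : MemLp id 3 (Measure.dirac (0 : EuclideanSpace ℝ (Fin K))) :=
    MemLp.of_bound (by fun_prop) 0 (by simp [ae_dirac_eq])
  have hmain := abs_integral_iterate_conv_sub_le hf hM₃ (hscaled hμ) (hscaled hγ) hdirac
    (by
      rw [integral_map (by fun_prop) (by fun_prop), integral_map (by fun_prop) (by fun_prop),
        integral_smul, integral_smul, hmean, hγdef, integral_id_multivariateGaussian])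
    (fun B => by rw [hscaled_diag, hscaled_diag, hB]) n
  have hmeas : Measurable fun z : Fin K → ℝ => (WithLp.equiv 2 (Fin K → ℝ)).symm (Q.mulVec z) := by
    change Measurable fun z : Fin K → ℝ => WithLp.toLp 2 (Q.mulVec z)
    fun_prop
  have hlaw : ∫ x, f x ∂γ = ∫ z : Fin K → ℝ, f ((WithLp.equiv 2 (Fin K → ℝ)).symm (Q.mulVec z))
      ∂(Measure.pi fun _ => gaussianReal 0 1) := by
    rw [hγdef, ← hQsq, ← map_pi_mulVec_eq_multivariateGaussian hQ,
      integral_map hmeas.aemeasurable hf.continuous.aestronglyMeasurable]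
  rw [← map_smul_sum_pi_eq_iterate_conv, ← multivariateGaussian_eq_iterate_conv hS hnc, hlaw,
    integral_map (by fun_prop) hf.continuous.aestronglyMeasurable,
    hscaled_norm, hscaled_norm] at hmain
  refine hmain.trans ?_
  have hM₂0 : 0 ≤ M₂ := (norm_nonneg _).trans (hM₂ 0)
  have hM₃0 : 0 ≤ M₃ := (norm_nonneg _).trans (hM₃ 0)
  have hμ3 : 0 ≤ ∫ x, ‖x‖ ^ 3 ∂μX := integral_nonneg fun x => by positivity
  have hsecond : 0 ≤ Real.sqrt K / 4 * M₂ * Real.sqrt (∫ x, ‖x‖ ^ 4 ∂μX) := by positivity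
  calc n * (M₃ / 6 * (c ^ 3 * ∫ x, ‖x‖ ^ 3 ∂μX + c ^ 3 * ∫ x, ‖x‖ ^ 3 ∂γ))
      = c * (M₃ / 6 * (∫ x, ‖x‖ ^ 3 ∂μX + ∫ x, ‖x‖ ^ 3 ∂γ)) := by
        linear_combination (c * (M₃ / 6 * (∫ x, ‖x‖ ^ 3 ∂μX + ∫ x, ‖x‖ ^ 3 ∂γ))) * hnc
    _ ≤ _ := by
        gcongr
        nlinarith [mul_le_mul_of_nonneg_left hγ3 hM₃0, mul_nonneg hM₃0 hμ3]
end

section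
/- Let X_1, …, X_n be i.i.d. random vectors in ℝ^K with E[X_1] = 0, covariance matrix Σ, and E‖X_1‖₂⁴ < ∞. Let S_n = n^{−1/2} Σ_{j=1}^{n} X_j, let Z be a standard Gaussian vector in ℝ^K, and let Σ^{1/2} denote the positive semidefinite square root of Σ. Then there exists a constant C > 0, depending only on K, sqrt(E‖X_1‖₂⁴) and E‖X_1‖₂³, such that for every n ≥ 1 and every function f : ℝ^K → ℝ that is 1-Lipschitz and bounded by 1 in absolute value, |E f(S_n) − E f(Σ^{1/2} Z)| ≤ C · n^{−1/6}. -/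
open MeasureTheory ProbabilityTheory

lemma abs_sub_taylor_two_le {f f₁ f₂ f₃ : ℝ → ℝ} {M : ℝ}
    (h₀ : ∀ s, HasDerivAt f (f₁ s) s) (h₁ : ∀ s, HasDerivAt f₁ (f₂ s) s)
    (h₂ : ∀ s, HasDerivAt f₂ (f₃ s) s) (hM : ∀ s, |f₃ s| ≤ M) :
    |f 1 - f 0 - f₁ 0 - f₂ 0 / 2| ≤ M := by
  have hM0 : 0 ≤ M := (abs_nonneg _).trans (hM 0)
  have mvt : ∀ {g g' : ℝ → ℝ}, (∀ s, HasDerivAt g (g' s) s) →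
      (∀ s ∈ Set.Icc (0 : ℝ) 1, |g' s| ≤ M) → ∀ s ∈ Set.Icc (0 : ℝ) 1, |g s - g 0| ≤ M := by
    intro g g' hg hb s hs
    have := (convex_Icc (0 : ℝ) 1).norm_image_sub_le_of_norm_hasDerivWithin_le (C := M)
      (fun x _ => (hg x).hasDerivWithinAt) hb (Set.left_mem_Icc.2 zero_le_one) hs
    refine this.trans ?_
    rw [sub_zero, Real.norm_of_nonneg hs.1]
    exact mul_le_of_le_one_right hM0 hs.2
  have b₂ := mvt h₂ (fun s _ => hM s)
  have d₁ : ∀ s, HasDerivAt (fun s => f₁ s - s * f₂ 0) (f₂ s - f₂ 0) s := fun s => by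
    have := (h₁ s).fun_sub ((hasDerivAt_id s).mul_const (f₂ 0))
    rwa [one_mul] at this
  have b₁ := mvt d₁ b₂
  have d₀ : ∀ s, HasDerivAt (fun s => f s - s * f₁ 0 - s ^ 2 / 2 * f₂ 0)
      (f₁ s - s * f₂ 0 - (f₁ 0 - 0 * f₂ 0)) s := fun s => by
    have := ((h₀ s).fun_sub ((hasDerivAt_id s).mul_const (f₁ 0))).fun_sub
      ((((hasDerivAt_id s).fun_pow 2).div_const 2).mul_const (f₂ 0))
    refine this.congr_deriv ?_
    simp
    ring
  have b₀ := mvt d₀ b₁ 1 (Set.right_mem_Icc.2 zero_le_one)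
  convert b₀ using 2
  ring

section Smoothing

open scoped Convolution
open ContinuousLinearMap (lsmul)

variable {E F : Type*} [NormedAddCommGroup E] [NormedSpace ℝ E] [FiniteDimensional ℝ E]
  [MeasurableSpace E] [BorelSpace E] {μ : Measure E} [μ.IsAddHaarMeasure]
  [NormedAddCommGroup F] [NormedSpace ℝ F]

lemma hasFDerivAt_convolution_lsmul {g : E → ℝ} (hg : Continuous g) {ψ : E → F}
    (hψ : ContDiff ℝ 1 ψ) (hc : HasCompactSupport ψ) (x : E) :
    HasFDerivAt (g ⋆[lsmul ℝ ℝ, μ] ψ) ((g ⋆[lsmul ℝ ℝ, μ] fderiv ℝ ψ) x) x := by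
  have h := hc.hasFDerivAt_convolution_right (lsmul ℝ ℝ : ℝ →L[ℝ] F →L[ℝ] F)
    (hg.locallyIntegrable (μ := μ)) hψ x
  have hp : (lsmul ℝ ℝ : ℝ →L[ℝ] F →L[ℝ] F).precompR E = lsmul ℝ ℝ := by
    ext; simp
  rwa [hp] at h

lemma integrable_smul_comp_sub {g : E → ℝ} (hg : Continuous g) {ψ : E → F}
    (hψ : Continuous ψ) (hc : HasCompactSupport ψ) (x : E) :
    Integrable (fun t => g t • ψ (x - t)) μ :=
  hc.convolutionExists_right (lsmul ℝ ℝ) (hg.locallyIntegrable (μ := μ)) hψ x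

lemma convolution_sub_const {g : E → ℝ} (hg : Continuous g) {ψ : E → F}
    (hψ : Continuous ψ) (hc : HasCompactSupport ψ) (c : ℝ) (x : E) :
    ((fun t => g t - c) ⋆[lsmul ℝ ℝ, μ] ψ) x
      = (g ⋆[lsmul ℝ ℝ, μ] ψ) x - c • ∫ u, ψ u ∂μ := by
  simp only [convolution_lsmul, sub_smul]
  rw [integral_sub (integrable_smul_comp_sub hg hψ hc x)
    (integrable_smul_comp_sub continuous_const hψ hc x), integral_smul,
    integral_sub_left_eq_self ψ μ x]

lemma norm_convolution_sub_le {g : E → ℝ} (hg : LipschitzWith 1 g) {ψ : E → F}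
    (hψ : Continuous ψ) (hc : HasCompactSupport ψ) (x : E) :
    ‖((fun t => g t - g x) ⋆[lsmul ℝ ℝ, μ] ψ) x‖ ≤ ∫ u, ‖u‖ * ‖ψ u‖ ∂μ := by
  rw [convolution_lsmul, ← integral_sub_left_eq_self (fun u => ‖u‖ * ‖ψ u‖) μ x]
  refine norm_integral_le_of_norm_le ?_ (Filter.Eventually.of_forall fun t => ?_)
  · have h : Integrable (fun u => ‖u‖ * ‖ψ u‖) μ :=
      (continuous_norm.mul hψ.norm).integrable_of_hasCompactSupport hc.norm.mul_left
    exact h.comp_sub_left x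
  · rw [norm_smul]
    gcongr
    have := hg.dist_le_mul t x
    simpa [dist_eq_norm, norm_sub_rev] using this

lemma norm_convolution_fderiv_le {g : E → ℝ} (hg : LipschitzWith 1 g) {ψ : E → F}
    (hψ : ContDiff ℝ 1 ψ) (hc : HasCompactSupport ψ) (x : E) :
    ‖(g ⋆[lsmul ℝ ℝ, μ] fderiv ℝ ψ) x‖ ≤ ∫ u, ‖u‖ * ‖fderiv ℝ ψ u‖ ∂μ := by
  have h₁ := hasFDerivAt_convolution_lsmul (μ := μ) hg.continuous hψ hc x
  have h₂ := hasFDerivAt_convolution_lsmul (μ := μ)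
    (hg.continuous.sub (continuous_const (y := g x))) hψ hc x
  have h₃ : ((fun t => g t - g x) ⋆[lsmul ℝ ℝ, μ] ψ)
      = fun y => (g ⋆[lsmul ℝ ℝ, μ] ψ) y - g x • ∫ u, ψ u ∂μ :=
    funext fun y => convolution_sub_const hg.continuous hψ.continuous hc _ y
  have h₄ := h₁.sub_const (g x • ∫ u, ψ u ∂μ)
  rw [← h₃] at h₄
  rw [h₄.unique h₂]
  exact norm_convolution_sub_le hg (hψ.continuous_fderiv one_ne_zero) (hc.fderiv ℝ) x

variable (E) in
set_option maxSynthPendingDepth 3 in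
/-- Lipschitz functions can be approximated, uniformly at distance `t`, by functions with a
second order expansion at every point whose cubic remainder has constant of order `t⁻²`. -/
theorem exists_smoothing : ∃ C : ℝ, 0 ≤ C ∧ ∀ f : E → ℝ, LipschitzWith 1 f → ∀ t : ℝ, 0 < t →
    ∃ G : E → ℝ, Continuous G ∧ (∀ x, |G x - f x| ≤ C * t) ∧
      ∀ x, ∃ (L : E →L[ℝ] ℝ) (B : E →L[ℝ] E →L[ℝ] ℝ), ∀ h,
        |G (x + h) - G x - L h - B h h| ≤ C * (t ^ 2)⁻¹ * ‖h‖ ^ 3 := by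
  let μ : Measure E := Measure.addHaar
  let b : ContDiffBump (0 : E) := ⟨1, 2, one_pos, one_lt_two⟩
  let φ : E → ℝ := b.normed μ
  have hφ : ContDiff ℝ 3 φ := b.contDiff_normed
  have hc : HasCompactSupport φ := b.hasCompactSupport_normed
  have hφ₁ : ContDiff ℝ 2 (fderiv ℝ φ) := hφ.fderiv_right (by norm_num)
  have hφ₂ : ContDiff ℝ 1 (fderiv ℝ (fderiv ℝ φ)) := hφ₁.fderiv_right (by norm_num)
  have hc₁ := hc.fderiv ℝ
  have hc₂ := hc₁.fderiv ℝ
  let C₀ := ∫ u, ‖u‖ * ‖φ u‖ ∂μ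
  let C₃ := ∫ u, ‖u‖ * ‖fderiv ℝ (fderiv ℝ (fderiv ℝ φ)) u‖ ∂μ
  have hC₀ : 0 ≤ C₀ := by positivity
  have hC₃ : 0 ≤ C₃ := by positivity
  refine ⟨C₀ + C₃, by positivity, fun f hf t ht => ?_⟩
  let g : E → ℝ := fun y => t⁻¹ * f (t • y)
  have hg : LipschitzWith 1 g := by
    refine LipschitzWith.of_dist_le_mul fun x y => ?_
    have := hf.dist_le_mul (t • x) (t • y)
    rw [dist_smul₀, Real.norm_of_nonneg ht.le, NNReal.coe_one, one_mul, Real.dist_eq] at this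
    rw [Real.dist_eq, ← mul_sub, abs_mul, abs_of_pos (inv_pos.2 ht), NNReal.coe_one, one_mul]
    rwa [inv_mul_le_iff₀ ht]
  let H := g ⋆[lsmul ℝ ℝ, μ] φ
  let H₁ := g ⋆[lsmul ℝ ℝ, μ] fderiv ℝ φ
  let H₂ := g ⋆[lsmul ℝ ℝ, μ] fderiv ℝ (fderiv ℝ φ)
  let H₃ := g ⋆[lsmul ℝ ℝ, μ] fderiv ℝ (fderiv ℝ (fderiv ℝ φ))
  have d₀ : ∀ x, HasFDerivAt H (H₁ x) x :=
    hasFDerivAt_convolution_lsmul hg.continuous (hφ.of_le (by norm_num)) hc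
  have d₁ : ∀ x, HasFDerivAt H₁ (H₂ x) x :=
    hasFDerivAt_convolution_lsmul hg.continuous (hφ₁.of_le (by norm_num)) hc₁
  have d₂ : ∀ x, HasFDerivAt H₂ (H₃ x) x :=
    hasFDerivAt_convolution_lsmul hg.continuous hφ₂ hc₂
  have hH : ∀ x, |H x - g x| ≤ C₀ := by
    intro x
    have h := norm_convolution_sub_le (μ := μ) hg hφ.continuous hc x
    rw [convolution_sub_const hg.continuous hφ.continuous hc, b.integral_normed] at h
    simpa [H, C₀] using h
  have hT : ∀ x h, |H (x + h) - H x - H₁ x h - H₂ x h h / 2| ≤ C₃ * ‖h‖ ^ 3 := by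
    intro x h
    have line : ∀ s : ℝ, HasDerivAt (fun s : ℝ => x + s • h) h s := fun s => by
      simpa using ((hasDerivAt_id s).smul_const h).const_add x
    have e₀ : ∀ s : ℝ, HasDerivAt (fun s : ℝ => H (x + s • h)) (H₁ (x + s • h) h) s :=
      fun s => (d₀ _).comp_hasDerivAt s (line s)
    have e₁ : ∀ s : ℝ, HasDerivAt (fun s : ℝ => H₁ (x + s • h) h) (H₂ (x + s • h) h h) s :=
      fun s => by
        simpa using ((d₁ _).comp_hasDerivAt s (line s)).clm_apply (hasDerivAt_const s h)
    have e₂ : ∀ s : ℝ, HasDerivAt (fun s : ℝ => H₂ (x + s • h) h h) (H₃ (x + s • h) h h h) s :=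
      fun s => by
        simpa using (((d₂ _).comp_hasDerivAt s (line s)).clm_apply
          (hasDerivAt_const s h)).clm_apply (hasDerivAt_const s h)
    have := abs_sub_taylor_two_le (M := C₃ * ‖h‖ ^ 3) e₀ e₁ e₂ fun s => by
      have h₃ : ‖H₃ (x + s • h)‖ ≤ C₃ := norm_convolution_fderiv_le hg hφ₂ hc₂ _
      calc |H₃ (x + s • h) h h h| ≤ ‖H₃ (x + s • h) h h‖ * ‖h‖ := by
            rw [← Real.norm_eq_abs]; exact ContinuousLinearMap.le_opNorm _ _
        _ ≤ ‖H₃ (x + s • h) h‖ * ‖h‖ * ‖h‖ := by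
            gcongr; exact ContinuousLinearMap.le_opNorm _ _
        _ ≤ ‖H₃ (x + s • h)‖ * ‖h‖ * ‖h‖ * ‖h‖ := by
            gcongr; exact ContinuousLinearMap.le_opNorm _ _
        _ ≤ C₃ * ‖h‖ * ‖h‖ * ‖h‖ := by gcongr
        _ = C₃ * ‖h‖ ^ 3 := by ring
    simpa using this
  refine ⟨fun x => t * H (t⁻¹ • x), ?_, fun x => ?_, fun x => ?_⟩
  · have : Continuous H := continuous_iff_continuousAt.2 fun x => (d₀ x).continuousAt
    fun_prop
  · have h := hH (t⁻¹ • x)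
    have e : t * H (t⁻¹ • x) - f x = t * (H (t⁻¹ • x) - g (t⁻¹ • x)) := by
      simp only [g, smul_inv_smul₀ ht.ne']
      field_simp
    rw [e, abs_mul, abs_of_pos ht, mul_comm]
    gcongr
    linarith
  · refine ⟨H₁ (t⁻¹ • x), (t⁻¹ / 2) • H₂ (t⁻¹ • x), fun h => ?_⟩
    have := hT (t⁻¹ • x) (t⁻¹ • h)
    have e : t * H (t⁻¹ • (x + h)) - t * H (t⁻¹ • x) - H₁ (t⁻¹ • x) h
        - ((t⁻¹ / 2) • H₂ (t⁻¹ • x)) h h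
        = t * (H (t⁻¹ • x + t⁻¹ • h) - H (t⁻¹ • x) - H₁ (t⁻¹ • x) (t⁻¹ • h)
          - H₂ (t⁻¹ • x) (t⁻¹ • h) (t⁻¹ • h) / 2) := by
      simp [smul_add]
      field_simp
    rw [e, abs_mul, abs_of_pos ht]
    calc t * _ ≤ t * (C₃ * ‖t⁻¹ • h‖ ^ 3) := by gcongr
      _ = C₃ * (t ^ 2)⁻¹ * ‖h‖ ^ 3 := by
        rw [norm_smul, norm_inv, Real.norm_of_nonneg ht.le]
        field_simp
      _ ≤ (C₀ + C₃) * (t ^ 2)⁻¹ * ‖h‖ ^ 3 := by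
        gcongr
        linarith

end Smoothing

section Replacement

variable {E : Type*} [NormedAddCommGroup E] [MeasurableSpace E] [BorelSpace E]
  [SecondCountableTopology E]

lemma integral_pi_sum_succ (μ : Measure E) [IsProbabilityMeasure μ] {f : E → ℝ}
    (hf : Continuous f) {M : ℝ} (hM : ∀ x, |f x| ≤ M) (n : ℕ) (x : E) :
    ∫ ξ : Fin (n + 1) → E, f (x + ∑ j, ξ j) ∂(Measure.pi fun _ => μ)
      = ∫ a, ∫ ξ : Fin n → E, f (x + a + ∑ j, ξ j) ∂(Measure.pi fun _ => μ) ∂μ := by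
  rw [← ((measurePreserving_piFinSuccAbove (fun _ : Fin (n + 1) => μ) 0).symm).integral_comp',
    integral_prod]
  · simp [MeasurableEquiv.piFinSuccAbove_symm_apply, Fin.sum_univ_succ, add_assoc]
  · refine Integrable.of_bound ?_ M (Filter.Eventually.of_forall fun _ => hM _)
    simp only [MeasurableEquiv.piFinSuccAbove_symm_apply, Fin.insertNthEquiv_apply,
      Fin.insertNth_zero', Fin.sum_univ_succ, Fin.cons_zero, Fin.cons_succ]
    exact Continuous.aestronglyMeasurable (by fun_prop)

lemma integrable_of_continuous_of_bounded {X : Type*} [TopologicalSpace X] [MeasurableSpace X]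
    [OpensMeasurableSpace X] [SecondCountableTopology X] {P : Measure X} [IsFiniteMeasure P]
    {f : X → ℝ} (hf : Continuous f) {M : ℝ} (hM : ∀ x, |f x| ≤ M) : Integrable f P :=
  Integrable.of_bound hf.aestronglyMeasurable M (Filter.Eventually.of_forall hM)

/-- If replacing one summand distributed as `μ` by one distributed as `ν` changes expectations
of translates of `f` by at most `ε`, then replacing `n` independent summands changes them by at
most `n * ε`. -/
theorem abs_integral_pi_sum_sub_le {μ ν : Measure E} [IsProbabilityMeasure μ]
    [IsProbabilityMeasure ν] {f : E → ℝ} (hf : Continuous f) {M : ℝ} (hM : ∀ x, |f x| ≤ M)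
    {ε : ℝ} (h : ∀ x, |∫ a, f (x + a) ∂μ - ∫ a, f (x + a) ∂ν| ≤ ε) (n : ℕ) (x : E) :
    |∫ ξ : Fin n → E, f (x + ∑ j, ξ j) ∂(Measure.pi fun _ => μ)
      - ∫ ξ : Fin n → E, f (x + ∑ j, ξ j) ∂(Measure.pi fun _ => ν)| ≤ n * ε := by
  induction n generalizing x with
  | zero => simp
  | succ n ih =>
    rw [integral_pi_sum_succ μ hf hM, integral_pi_sum_succ ν hf hM]
    let Pμ : Measure (Fin n → E) := Measure.pi fun _ => μ
    let Pν : Measure (Fin n → E) := Measure.pi fun _ => ν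
    have prod_int : ∀ (ρ : Measure E) [IsProbabilityMeasure ρ] (P : Measure (Fin n → E))
        [IsProbabilityMeasure P],
        Integrable (fun p : E × (Fin n → E) => f (x + p.1 + ∑ j, p.2 j)) (ρ.prod P) :=
      fun ρ _ P _ => integrable_of_continuous_of_bounded (by fun_prop) fun _ => hM _
    have A : |∫ a, ∫ ξ, f (x + a + ∑ j, ξ j) ∂Pμ ∂μ - ∫ a, ∫ ξ, f (x + a + ∑ j, ξ j) ∂Pν ∂μ|
        ≤ n * ε := by
      rw [← integral_sub (prod_int μ Pμ).integral_prod_left (prod_int μ Pν).integral_prod_left,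
        ← Real.norm_eq_abs]
      have key : ∀ a, ‖∫ ξ, f (x + a + ∑ j, ξ j) ∂Pμ - ∫ ξ, f (x + a + ∑ j, ξ j) ∂Pν‖
          ≤ n * ε := fun a => ih (x + a)
      simpa using norm_integral_le_of_norm_le_const (μ := μ) (Filter.Eventually.of_forall key)
    have B : |∫ a, ∫ ξ, f (x + a + ∑ j, ξ j) ∂Pν ∂μ - ∫ a, ∫ ξ, f (x + a + ∑ j, ξ j) ∂Pν ∂ν|
        ≤ ε := by
      have swap : ∀ (ρ : Measure E) [IsProbabilityMeasure ρ],
          ∫ a, ∫ ξ, f (x + a + ∑ j, ξ j) ∂Pν ∂ρ = ∫ ξ, ∫ a, f (x + a + ∑ j, ξ j) ∂ρ ∂Pν :=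
        fun ρ _ => integral_integral_swap (prod_int ρ Pν)
      rw [swap μ, swap ν,
        ← integral_sub (prod_int μ Pν).integral_prod_right (prod_int ν Pν).integral_prod_right,
        ← Real.norm_eq_abs]
      have key : ∀ ξ : Fin n → E, ‖∫ a, f (x + a + ∑ j, ξ j) ∂μ - ∫ a, f (x + a + ∑ j, ξ j) ∂ν‖
          ≤ ε := fun ξ => by simpa [add_right_comm] using h (x + ∑ j, ξ j)
      simpa using norm_integral_le_of_norm_le_const (μ := Pν) (Filter.Eventually.of_forall key)
    calc _ ≤ n * ε + ε := (abs_sub_le _ _ _).trans (add_le_add A B)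
      _ = _ := by push_cast; ring

/-- One-step comparison for measures with the same first and second moments. -/
theorem abs_integral_add_sub_le_of_taylor [NormedSpace ℝ E] {μ ν : Measure E}
    [IsProbabilityMeasure μ] [IsProbabilityMeasure ν]
    (hμ : Integrable (fun x => ‖x‖ ^ 3) μ) (hν : Integrable (fun x => ‖x‖ ^ 3) ν)
    (h₁ : ∀ L : E →L[ℝ] ℝ, ∫ a, L a ∂μ = ∫ a, L a ∂ν)
    (h₂ : ∀ B : E →L[ℝ] E →L[ℝ] ℝ, ∫ a, B a a ∂μ = ∫ a, B a a ∂ν)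
    {f : E → ℝ} (hf : Continuous f) {M : ℝ} (hM : ∀ x, |f x| ≤ M) {C : ℝ} {x : E}
    {L : E →L[ℝ] ℝ} {B : E →L[ℝ] E →L[ℝ] ℝ}
    (hT : ∀ a, |f (x + a) - f x - L a - B a a| ≤ C * ‖a‖ ^ 3) :
    |∫ a, f (x + a) ∂μ - ∫ a, f (x + a) ∂ν| ≤ C * (∫ a, ‖a‖ ^ 3 ∂μ + ∫ a, ‖a‖ ^ 3 ∂ν) := by
  have main : ∀ (ρ : Measure E) [IsProbabilityMeasure ρ], Integrable (fun x => ‖x‖ ^ 3) ρ →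
      |∫ a, f (x + a) ∂ρ - f x - ∫ a, L a ∂ρ - ∫ a, B a a ∂ρ| ≤ C * ∫ a, ‖a‖ ^ 3 ∂ρ := by
    intro ρ _ hρ
    have hL : Integrable (fun a => L a) ρ := by
      refine (((integrable_const (1 : ℝ)).add hρ).const_mul ‖L‖).mono' (by fun_prop)
        (Filter.Eventually.of_forall fun a => (L.le_opNorm a).trans ?_)
      refine mul_le_mul_of_nonneg_left (?_ : ‖a‖ ≤ 1 + ‖a‖ ^ 3) (norm_nonneg _)
      nlinarith [norm_nonneg a, sq_nonneg (‖a‖ - 1), pow_nonneg (norm_nonneg a) 3,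
        mul_nonneg (norm_nonneg a) (sq_nonneg (‖a‖ - 1))]
    have hB : Integrable (fun a => B a a) ρ := by
      refine (((integrable_const (1 : ℝ)).add hρ).const_mul ‖B‖).mono' (by fun_prop)
        (Filter.Eventually.of_forall fun a => (B.le_opNorm₂ a a).trans ?_)
      rw [mul_assoc]
      refine mul_le_mul_of_nonneg_left (?_ : ‖a‖ * ‖a‖ ≤ 1 + ‖a‖ ^ 3) (by positivity)
      nlinarith [norm_nonneg a, mul_nonneg (norm_nonneg a) (sq_nonneg (‖a‖ - 1)),
        sq_nonneg (‖a‖ - 1)]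
    have hF : Integrable (fun a => f (x + a)) ρ :=
      integrable_of_continuous_of_bounded (by fun_prop) fun _ => hM _
    have e : ∫ a, f (x + a) ∂ρ - f x - ∫ a, L a ∂ρ - ∫ a, B a a ∂ρ
        = ∫ a, (f (x + a) - f x - L a - B a a) ∂ρ := by
      have hF' : Integrable (fun a => f (x + a) - f x) ρ := hF.sub (integrable_const _)
      have hFL : Integrable (fun a => f (x + a) - f x - L a) ρ := hF'.sub hL
      rw [integral_sub hFL hB, integral_sub hF' hL, integral_sub hF (integrable_const _)]
      simp
    rw [e, ← Real.norm_eq_abs, ← integral_const_mul]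
    exact norm_integral_le_of_norm_le (hρ.const_mul C) (Filter.Eventually.of_forall hT)
  have hm := abs_le.1 (main μ hμ)
  have hn := abs_le.1 (main ν hν)
  rw [h₁ L, h₂ B] at hm
  rw [abs_le, mul_add]
  constructor <;> linarith [hm.1, hm.2, hn.1, hn.2]

end Replacement

section GaussianImage

variable {E : Type*} [NormedAddCommGroup E] [InnerProductSpace ℝ E] [FiniteDimensional ℝ E]
  [MeasurableSpace E] [BorelSpace E]

lemma charFun_stdGaussian_map (A : E →L[ℝ] E) (t : E) :
    charFun ((stdGaussian E).map A) t = Complex.exp (-‖A.adjoint t‖ ^ 2 / 2) := by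
  rw [← charFun_stdGaussian, charFun_apply, charFun_apply,
    integral_map A.continuous.aemeasurable (Continuous.aestronglyMeasurable (by fun_prop))]
  simp_rw [ContinuousLinearMap.adjoint_inner_right]

/-- Centered Gaussian measures are stable under normalized sums of independent copies. -/
lemma map_sum_pi_stdGaussian_map (A : E →L[ℝ] E) {n : ℕ} (hn : 1 ≤ n) :
    (Measure.pi fun _ : Fin n => (stdGaussian E).map A).map
      (fun x => (Real.sqrt n)⁻¹ • ∑ j, x j) = (stdGaussian E).map A := by
  have : IsProbabilityMeasure ((stdGaussian E).map A) :=
    Measure.isProbabilityMeasure_map A.continuous.aemeasurable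
  have hn' : (n : ℝ) ≠ 0 := by positivity
  have hcomp : (fun x : Fin n → E => (Real.sqrt n)⁻¹ • ∑ j, x j)
      = (fun y => (Real.sqrt n)⁻¹ • y) ∘ fun x => ∑ j, x j := rfl
  apply Measure.ext_of_charFun
  ext t
  rw [hcomp, ← Measure.map_map (by fun_prop) (by fun_prop), charFun_map_smul,
    charFun_map_sum_pi_eq_prod]
  simp only [Finset.prod_apply, Finset.prod_const, charFun_stdGaussian_map, map_smul, norm_smul,
    Finset.card_univ, Fintype.card_fin]
  rw [← Complex.exp_nat_mul]
  congr 1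
  have : ((Real.sqrt n : ℂ)) ^ 2 = n := by
    rw [← Complex.ofReal_pow, Real.sq_sqrt (by positivity), Complex.ofReal_natCast]
  have hn'' : (n : ℂ) ≠ 0 := by exact_mod_cast hn'
  simp only [norm_inv, Real.norm_of_nonneg (Real.sqrt_nonneg _)]
  push_cast
  rw [mul_pow, inv_pow, this]
  field_simp

lemma integral_inner_mul_inner_stdGaussian_map (A : E →L[ℝ] E) (x y : E) :
    ∫ z, inner ℝ x z * inner ℝ y z ∂((stdGaussian E).map A)
      = inner ℝ (A.adjoint x) (A.adjoint y) := by
  have h := covarianceBilin_apply (IsGaussian.memLp_two_id (μ := (stdGaussian E).map A)) x y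
  have h₀ : ((stdGaussian E).map A)[id] = 0 := by
    simpa using A.integral_id_map (IsGaussian.integrable_id (μ := stdGaussian E))
  rw [covarianceBilin_map IsGaussian.memLp_two_id, covarianceBilin_stdGaussian,
    innerSL_apply_apply, h₀] at h
  simpa using h.symm

end GaussianImage

section Euclidean

variable {ι : Type*} [Fintype ι] [DecidableEq ι]

lemma integral_bilin_eq_sum {ρ : Measure (EuclideanSpace ℝ ι)}
    (hρ : Integrable (fun x => ‖x‖ ^ 2) ρ)
    (B : EuclideanSpace ℝ ι →L[ℝ] EuclideanSpace ℝ ι →L[ℝ] ℝ) :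
    ∫ x, B x x ∂ρ = ∑ i, ∑ j, (∫ x, x i * x j ∂ρ) *
      B (EuclideanSpace.single i 1) (EuclideanSpace.single j 1) := by
  have hint : ∀ i j, Integrable (fun x : EuclideanSpace ℝ ι => x i * x j) ρ := fun i j => by
    refine hρ.mono' (Continuous.aestronglyMeasurable (by fun_prop))
      (Filter.Eventually.of_forall fun x => ?_)
    rw [norm_mul, sq]
    exact mul_le_mul (PiLp.norm_apply_le x i) (PiLp.norm_apply_le x j) (norm_nonneg _)
      (norm_nonneg _)
  have hx : ∀ x : EuclideanSpace ℝ ι, B x x = ∑ i, ∑ j, (x i * x j) *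
      B (EuclideanSpace.single i 1) (EuclideanSpace.single j 1) := fun x => by
    have e : x = ∑ i, x i • EuclideanSpace.single i (1 : ℝ) := by
      ext j; simp [Pi.single_apply]
    conv_lhs => rw [e]
    simp only [map_sum, map_smul, sum_apply, smul_apply, smul_eq_mul,
      Finset.mul_sum, mul_assoc]
    rw [Finset.sum_comm]
    exact Finset.sum_congr rfl fun i _ => Finset.sum_congr rfl fun j _ => mul_left_comm _ _ _
  simp_rw [hx]
  rw [integral_finsetSum _ fun i _ => integrable_finsetSum _ fun j _ => (hint i j).mul_const _]
  refine Finset.sum_congr rfl fun i _ => ?_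
  rw [integral_finsetSum _ fun j _ => (hint i j).mul_const _]
  simp_rw [integral_mul_const]

lemma adjoint_toEuclideanCLM {Q : Matrix ι ι ℝ} (hQ : Q.IsHermitian) :
    (Matrix.toEuclideanCLM (𝕜 := ℝ) Q).adjoint = Matrix.toEuclideanCLM (𝕜 := ℝ) Q := by
  rw [← ContinuousLinearMap.star_eq_adjoint, ← map_star, Matrix.star_eq_conjTranspose, hQ.eq]

lemma integral_apply_mul_apply_stdGaussian_map {Q : Matrix ι ι ℝ} (hQ : Q.IsHermitian) (i j : ι) :
    ∫ z, z i * z j ∂((stdGaussian (EuclideanSpace ℝ ι)).map (Matrix.toEuclideanCLM (𝕜 := ℝ) Q))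
      = (Q * Q) i j := by
  have h := integral_inner_mul_inner_stdGaussian_map (Matrix.toEuclideanCLM (𝕜 := ℝ) Q)
    (EuclideanSpace.single i (1 : ℝ)) (EuclideanSpace.single j (1 : ℝ))
  rw [ContinuousLinearMap.adjoint_inner_left, adjoint_toEuclideanCLM hQ,
    ← mul_apply_eq_comp, ← map_mul, Matrix.inner_toEuclideanCLM] at h
  simpa [EuclideanSpace.inner_single_left] using h

end Euclidean

section GaussianMoments

variable {E : Type*} [NormedAddCommGroup E] [InnerProductSpace ℝ E] [FiniteDimensional ℝ E]
  [MeasurableSpace E] [BorelSpace E]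

lemma integrable_norm_pow_of_isGaussian (ν : Measure E) [IsGaussian ν] (p : ℕ) :
    Integrable (fun x => ‖x‖ ^ p) ν :=
  (IsGaussian.memLp_id ν p (by simp)).integrable_norm_pow'

lemma opNorm_sq_le_of_second_moments {A : E →L[ℝ] E} {μ : Measure E}
    (hμ : Integrable (fun x => ‖x‖ ^ 2) μ)
    (h₂ : ∀ B : E →L[ℝ] E →L[ℝ] ℝ,
      ∫ a, B a a ∂μ = ∫ a, B a a ∂((stdGaussian E).map A)) :
    ‖A‖ ^ 2 ≤ ∫ x, ‖x‖ ^ 2 ∂μ := by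
  have hm : 0 ≤ ∫ x, ‖x‖ ^ 2 ∂μ := by positivity
  rw [← Real.le_sqrt (norm_nonneg _) hm, ← ContinuousLinearMap.adjoint.norm_map A]
  refine ContinuousLinearMap.opNorm_le_bound _ (Real.sqrt_nonneg _) fun z => ?_
  refine abs_le_of_sq_le_sq' ?_ (by positivity) |>.2
  have h := h₂ ((innerSL ℝ z).smulRight (innerSL ℝ z))
  simp only [ContinuousLinearMap.smulRight_apply, smul_apply,
    innerSL_apply_apply, smul_eq_mul] at h
  rw [integral_inner_mul_inner_stdGaussian_map, real_inner_self_eq_norm_sq] at h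
  rw [← h, mul_pow, Real.sq_sqrt hm, ← integral_mul_const]
  refine integral_mono_of_nonneg (Filter.Eventually.of_forall fun x => mul_self_nonneg _)
    (hμ.mul_const _) (Filter.Eventually.of_forall fun x => ?_)
  simp only [← sq, ← mul_pow]
  rw [mul_comm, ← sq_abs]
  gcongr
  exact abs_real_inner_le_norm z x

lemma integral_norm_pow_three_map_le (A : E →L[ℝ] E) :
    ∫ x, ‖x‖ ^ 3 ∂((stdGaussian E).map A) ≤ ‖A‖ ^ 3 * ∫ x, ‖x‖ ^ 3 ∂(stdGaussian E) := by
  rw [integral_map A.continuous.aemeasurable (Continuous.aestronglyMeasurable (by fun_prop)),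
    ← integral_const_mul]
  refine integral_mono_of_nonneg (Filter.Eventually.of_forall fun _ => by positivity)
    ((integrable_norm_pow_of_isGaussian _ 3).const_mul _)
    (Filter.Eventually.of_forall fun x => ?_)
  simp only [← mul_pow]
  gcongr
  exact A.le_opNorm x

end GaussianMoments

section Lindeberg

variable {E : Type*} [NormedAddCommGroup E] [NormedSpace ℝ E] [FiniteDimensional ℝ E]
  [MeasurableSpace E] [BorelSpace E]

variable (E) in
/-- Lindeberg's comparison, for bounded Lipschitz functions, of normalized sums of independent
copies of two laws with the same first and second moments. -/
theorem exists_abs_integral_normalized_sum_sub_le : ∃ C : ℝ, 0 ≤ C ∧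
    ∀ (μ ν : Measure E) [IsProbabilityMeasure μ] [IsProbabilityMeasure ν],
      Integrable (fun x => ‖x‖ ^ 3) μ → Integrable (fun x => ‖x‖ ^ 3) ν →
      (∀ L : E →L[ℝ] ℝ, ∫ a, L a ∂μ = ∫ a, L a ∂ν) →
      (∀ B : E →L[ℝ] E →L[ℝ] ℝ, ∫ a, B a a ∂μ = ∫ a, B a a ∂ν) →
      ∀ n : ℕ, 1 ≤ n → ∀ f : E → ℝ, LipschitzWith 1 f → (∀ x, |f x| ≤ 1) →
        |∫ ξ : Fin n → E, f ((Real.sqrt n)⁻¹ • ∑ j, ξ j) ∂(Measure.pi fun _ => μ)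
          - ∫ ξ : Fin n → E, f ((Real.sqrt n)⁻¹ • ∑ j, ξ j) ∂(Measure.pi fun _ => ν)|
        ≤ C * (2 + (∫ a, ‖a‖ ^ 3 ∂μ + ∫ a, ‖a‖ ^ 3 ∂ν)) * (n : ℝ) ^ (-(1 / 6 : ℝ)) := by
  obtain ⟨C, hC, hsmooth⟩ := exists_smoothing E
  refine ⟨C, hC, fun μ ν _ _ hμ hν h₁ h₂ n hn f hf hf1 => ?_⟩
  have hn0 : (0 : ℝ) < n := by exact_mod_cast hn
  set t : ℝ := (n : ℝ) ^ (-(1 / 6 : ℝ)) with ht_def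
  set c : ℝ := (Real.sqrt n)⁻¹ with hc_def
  have ht : 0 < t := Real.rpow_pos_of_pos hn0 _
  have hc : 0 < c := inv_pos.2 (Real.sqrt_pos.2 hn0)
  have htc : t ^ 3 = c := by
    rw [ht_def, hc_def, Real.sqrt_eq_rpow, ← Real.rpow_neg hn0.le, ← Real.rpow_natCast,
      ← Real.rpow_mul hn0.le]
    norm_num
  have hnc : n * c ^ 2 = 1 := by
    rw [hc_def, inv_pow, Real.sq_sqrt hn0.le, mul_inv_cancel₀ hn0.ne']
  obtain ⟨G, hGc, hGf, hGT⟩ := hsmooth f hf t ht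
  have hGb : ∀ x, |G x| ≤ C * t + 1 := fun x => by
    have := abs_add_le (G x - f x) (f x)
    rw [sub_add_cancel] at this
    linarith [hGf x, hf1 x]
  have smooth_err : ∀ (ρ : Measure E) [IsProbabilityMeasure ρ],
      |∫ ξ : Fin n → E, f (c • ∑ j, ξ j) ∂(Measure.pi fun _ => ρ)
        - ∫ ξ : Fin n → E, G (c • ∑ j, ξ j) ∂(Measure.pi fun _ => ρ)| ≤ C * t := by
    intro ρ _
    have hfc := hf.continuous
    have if₁ : Integrable (fun ξ : Fin n → E => f (c • ∑ j, ξ j)) (Measure.pi fun _ => ρ) :=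
      integrable_of_continuous_of_bounded (by fun_prop) fun ξ => hf1 _
    have if₂ : Integrable (fun ξ : Fin n → E => G (c • ∑ j, ξ j)) (Measure.pi fun _ => ρ) :=
      integrable_of_continuous_of_bounded (by fun_prop) fun ξ => hGb _
    rw [← integral_sub if₁ if₂, ← Real.norm_eq_abs]
    have key : ∀ ξ : Fin n → E, ‖f (c • ∑ j, ξ j) - G (c • ∑ j, ξ j)‖ ≤ C * t := fun ξ => by
      rw [Real.norm_eq_abs, abs_sub_comm]
      exact hGf _
    simpa using norm_integral_le_of_norm_le_const
      (μ := Measure.pi fun _ : Fin n => ρ) (Filter.Eventually.of_forall key)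
  have step : ∀ x, |∫ a, G (c • (x + a)) ∂μ - ∫ a, G (c • (x + a)) ∂ν|
      ≤ C * (t ^ 2)⁻¹ * c ^ 3 * (∫ a, ‖a‖ ^ 3 ∂μ + ∫ a, ‖a‖ ^ 3 ∂ν) := fun x => by
    obtain ⟨L, B, hLB⟩ := hGT (c • x)
    refine abs_integral_add_sub_le_of_taylor (f := fun y => G (c • y)) (L := c • L)
      (B := c ^ 2 • B) hμ hν h₁ h₂ (by fun_prop) (fun y => hGb _) fun a => ?_
    have := hLB (c • a)
    rw [norm_smul, Real.norm_of_nonneg hc.le, mul_pow, ← mul_assoc] at this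
    simpa [smul_add, sq, mul_assoc] using this
  have tele := abs_integral_pi_sum_sub_le (f := fun y => G (c • y)) (by fun_prop)
    (fun y => hGb (c • y)) step n 0
  simp only [zero_add] at tele
  have hrate : n * (C * (t ^ 2)⁻¹ * c ^ 3 * (∫ a, ‖a‖ ^ 3 ∂μ + ∫ a, ‖a‖ ^ 3 ∂ν))
      = C * (∫ a, ‖a‖ ^ 3 ∂μ + ∫ a, ‖a‖ ^ 3 ∂ν) * t := by
    have : (t ^ 2)⁻¹ * c = t := by
      rw [← htc]
      field_simp
    linear_combination (C * (∫ a, ‖a‖ ^ 3 ∂μ + ∫ a, ‖a‖ ^ 3 ∂ν) * ((t ^ 2)⁻¹ * c)) * hnc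
      + C * (∫ a, ‖a‖ ^ 3 ∂μ + ∫ a, ‖a‖ ^ 3 ∂ν) * this
  rw [hrate] at tele
  have e₁ := abs_le.1 (smooth_err μ)
  have e₂ := abs_le.1 (smooth_err ν)
  have e₃ := abs_le.1 tele
  rw [abs_le]
  constructor <;> nlinarith [e₁.1, e₁.2, e₂.1, e₂.2, e₃.1, e₃.2]

end Lindeberg

lemma integrable_norm_pow_of_le {E : Type*} [NormedAddCommGroup E] [MeasurableSpace E]
    [BorelSpace E] [SecondCountableTopology E] {μ : Measure E} [IsFiniteMeasure μ] {p q : ℕ}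
    (hpq : p ≤ q) (h : Integrable (fun x => ‖x‖ ^ q) μ) : Integrable (fun x => ‖x‖ ^ p) μ := by
  refine ((integrable_const (1 : ℝ)).add h).mono' (by fun_prop)
    (Filter.Eventually.of_forall fun x => ?_)
  have hx : 0 ≤ ‖x‖ ^ q := by positivity
  rw [Real.norm_of_nonneg (by positivity)]
  change ‖x‖ ^ p ≤ 1 + ‖x‖ ^ q
  rcases le_total ‖x‖ 1 with h1 | h1
  · linarith [pow_le_one₀ (n := p) (norm_nonneg x) h1]
  · linarith [pow_le_pow_right₀ h1 hpq]

lemma integral_norm_sq_le {E : Type*} [NormedAddCommGroup E] [MeasurableSpace E]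
    [BorelSpace E] [SecondCountableTopology E] {μ : Measure E} [IsProbabilityMeasure μ]
    (h : Integrable (fun x => ‖x‖ ^ 3) μ) : ∫ x, ‖x‖ ^ 2 ∂μ ≤ 1 + ∫ x, ‖x‖ ^ 3 ∂μ := by
  have e : 1 + ∫ x, ‖x‖ ^ 3 ∂μ = ∫ x, (1 + ‖x‖ ^ 3) ∂μ := by
    rw [integral_add (integrable_const _) h]
    simp
  rw [e]
  refine integral_mono (integrable_norm_pow_of_le (by norm_num) h)
    ((integrable_const _).add h) fun x => ?_
  change ‖x‖ ^ 2 ≤ 1 + ‖x‖ ^ 3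
  nlinarith [norm_nonneg x, mul_nonneg (norm_nonneg x) (sq_nonneg (‖x‖ - 1)), sq_nonneg (‖x‖ - 1)]

/-- There is a constant `C > 0`, depending only on `K`, `E‖X‖₂³`
and `√(E‖X‖₂⁴)`, such that for every i.i.d. mean-zero sample `X_1, …, X_n` in `ℝ^K`
with covariance `Σ` and finite fourth moment (encoded through the product law of
`μX`), every `n ≥ 1` and every `1`-Lipschitz function `f` bounded by `1`,
`|E f(S_n) − E f(Σ^{1/2} Z)| ≤ C n^{−1/6}`, where `S_n = n^{−1/2} Σ_j X_j` and
`Σ^{1/2}` is the positive semidefinite square root of `Σ`. -/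
theorem stmt16 (K : ℕ) (hK : 0 < K) :
    ∃ C : ℝ → ℝ → ℝ, (∀ m3 m4, 0 < C m3 m4) ∧
      ∀ (μX : Measure (EuclideanSpace ℝ (Fin K))) [IsProbabilityMeasure μX],
        Integrable (fun x => ‖x‖ ^ 4) μX →
        (∫ x, x ∂μX) = 0 →
        ∀ (Q : Matrix (Fin K) (Fin K) ℝ), Q.PosSemidef →
          (Q * Q = Matrix.of fun i j => ∫ x, x i * x j ∂μX) →
        ∀ n : ℕ, 1 ≤ n →
        ∀ f : EuclideanSpace ℝ (Fin K) → ℝ, LipschitzWith 1 f → (∀ x, |f x| ≤ 1) →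
          |(∫ x : Fin n → EuclideanSpace ℝ (Fin K),
                f ((Real.sqrt n)⁻¹ • ∑ j, x j) ∂(Measure.pi fun _ => μX))
              - ∫ z : Fin K → ℝ, f ((WithLp.equiv 2 (Fin K → ℝ)).symm (Q.mulVec z))
                  ∂(Measure.pi fun _ => gaussianReal 0 1)|
            ≤ C (∫ x, ‖x‖ ^ 3 ∂μX) (Real.sqrt (∫ x, ‖x‖ ^ 4 ∂μX))
                * (n : ℝ) ^ (-(1 / 6 : ℝ)) := by
  obtain ⟨C, hC, hbound⟩ :=
    exists_abs_integral_normalized_sum_sub_le (EuclideanSpace ℝ (Fin K))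
  set g₃ : ℝ := ∫ x, ‖x‖ ^ 3 ∂(stdGaussian (EuclideanSpace ℝ (Fin K))) with hg₃_def
  have hg₃ : 0 ≤ g₃ := by positivity
  refine ⟨fun m3 _ => C * (2 + (|m3| + (1 + |m3|) ^ 3 * g₃)) + 1, fun m3 _ => by positivity, ?_⟩
  intro μX _ hX4 hX0 Q hQ hQQ n hn f hf hf1
  have hX3 := integrable_norm_pow_of_le (p := 3) (by norm_num) hX4
  have hX2 := integrable_norm_pow_of_le (p := 2) (by norm_num) hX4
  have hX1 : Integrable (fun x => x) μX := by
    refine (integrable_norm_iff (by fun_prop)).1 ?_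
    simpa using integrable_norm_pow_of_le (p := 1) (by norm_num) hX4
  set A := Matrix.toEuclideanCLM (𝕜 := ℝ) Q with hA
  set ν := (stdGaussian (EuclideanSpace ℝ (Fin K))).map A with hν_def
  have hν : IsGaussian ν := inferInstance
  have h₁ : ∀ L : EuclideanSpace ℝ (Fin K) →L[ℝ] ℝ, ∫ a, L a ∂μX = ∫ a, L a ∂ν := by
    intro L
    rw [L.integral_comp_comm hX1, hX0, L.integral_comp_comm IsGaussian.integrable_fun_id, hν_def,
      A.integral_id_map IsGaussian.integrable_id, integral_id_stdGaussian, map_zero,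
      map_zero, map_zero]
  have h₂ : ∀ B : EuclideanSpace ℝ (Fin K) →L[ℝ] EuclideanSpace ℝ (Fin K) →L[ℝ] ℝ,
      ∫ a, B a a ∂μX = ∫ a, B a a ∂ν := by
    intro B
    rw [integral_bilin_eq_sum hX2, integral_bilin_eq_sum (integrable_norm_pow_of_isGaussian ν 2)]
    simp_rw [hν_def, hA, integral_apply_mul_apply_stdGaussian_map hQ.isHermitian, hQQ,
      Matrix.of_apply]
  set m₃ := ∫ x, ‖x‖ ^ 3 ∂μX with hm₃_def
  have hm₃ : 0 ≤ m₃ := by positivity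
  have hAm : ‖A‖ ≤ 1 + m₃ := by
    have := (opNorm_sq_le_of_second_moments hX2 h₂).trans (integral_norm_sq_le hX3)
    nlinarith [norm_nonneg A]
  have hν₃ : ∫ x, ‖x‖ ^ 3 ∂ν ≤ (1 + m₃) ^ 3 * g₃ :=
    (integral_norm_pow_three_map_le A).trans (by gcongr)
  have hlaw : ∫ z : Fin K → ℝ, f ((WithLp.equiv 2 (Fin K → ℝ)).symm (Q.mulVec z))
        ∂(Measure.pi fun _ => gaussianReal 0 1)
      = ∫ ξ : Fin n → EuclideanSpace ℝ (Fin K), f ((Real.sqrt n)⁻¹ • ∑ j, ξ j)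
        ∂(Measure.pi fun _ => ν) := by
    have hfc := hf.continuous
    rw [← integral_map (φ := fun x : Fin n → EuclideanSpace ℝ (Fin K) =>
        (Real.sqrt n)⁻¹ • ∑ j, x j) (Continuous.aemeasurable (by fun_prop))
        hfc.aestronglyMeasurable, map_sum_pi_stdGaussian_map A hn,
      integral_map A.continuous.aemeasurable hfc.aestronglyMeasurable, ← map_pi_eq_stdGaussian,
      integral_map (Measurable.aemeasurable (by fun_prop))
        (Continuous.aestronglyMeasurable (by fun_prop))]
    rfl
  rw [hlaw]
  refine (hbound μX ν hX3 (integrable_norm_pow_of_isGaussian ν 3) h₁ h₂ n hn f hf hf1).trans ?_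
  change C * (2 + (m₃ + ∫ a, ‖a‖ ^ 3 ∂ν)) * _
    ≤ (C * (2 + (|m₃| + (1 + |m₃|) ^ 3 * g₃)) + 1) * _
  rw [abs_of_nonneg hm₃]
  gcongr
  refine le_add_of_le_of_nonneg ?_ zero_le_one
  gcongr
end

section
/- Let π ∈ Δ_K with π_a > 0 for all a, h ∈ ℝ^K, s_a > 0, b > 0, and n ≥ 1. Define the K×K matrix Σ_n = diag(π_a s_a² / b) + (1/(bn)) · diag(π_a h_a²) − (1/(bn)) · (π ⊙ h)(π ⊙ h)ᵀ, where (π ⊙ h)_a = π_a h_a. Then Σ_n is symmetric positive definite, its largest eigenvalue satisfies λ_max(Σ_n) ≤ max_a (s_a² + h_a²)/b, and its smallest eigenvalue satisfies λ_min(Σ_n) ≥ (min_a π_a) · (min_a s_a²)/b. -/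
open Matrix in
theorem Matrix.IsHermitian.exists_eigenvalues_mul_dotProduct {ι : Type*} [Fintype ι]
    [DecidableEq ι] {A : Matrix ι ι ℝ} (hA : A.IsHermitian) (i : ι) :
    ∃ v : ι → ℝ, 0 < v ⬝ᵥ v ∧ v ⬝ᵥ A *ᵥ v = hA.eigenvalues i * (v ⬝ᵥ v) := by
  refine ⟨⇑(hA.eigenvectorBasis i), ?_, ?_⟩
  · refine (Finset.sum_nonneg fun j _ => mul_self_nonneg _).lt_of_ne' ?_
    intro h0
    replace h0 := dotProduct_self_eq_zero.1 h0
    exact hA.eigenvectorBasis.toBasis.ne_zero i (by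
      rw [OrthonormalBasis.coe_toBasis]
      ext j
      exact congrFun h0 j)
  · rw [hA.mulVec_eigenvectorBasis, dotProduct_smul, smul_eq_mul]

open Matrix in
theorem Matrix.dotProduct_diagonal_mulVec {ι : Type*} [Fintype ι] [DecidableEq ι] (d x : ι → ℝ) :
    x ⬝ᵥ diagonal d *ᵥ x = ∑ a, d a * x a ^ 2 := by
  simp only [dotProduct, mulVec_diagonal]
  exact Finset.sum_congr rfl fun a _ => by ring

open Matrix in
theorem Matrix.dotProduct_vecMulVec_mulVec {ι : Type*} [Fintype ι] (u x : ι → ℝ) :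
    x ⬝ᵥ vecMulVec u u *ᵥ x = (∑ a, u a * x a) ^ 2 := by
  rw [vecMulVec_mulVec, dotProduct_smul, dotProduct_comm x u]
  simp [dotProduct, sq]

theorem Finset.sq_sum_mul_le_sum_mul_sq {ι : Type*} {t : Finset ι} {w : ι → ℝ}
    (hw : ∀ a ∈ t, 0 ≤ w a) (hw1 : ∑ a ∈ t, w a = 1) (y : ι → ℝ) :
    (∑ a ∈ t, w a * y a) ^ 2 ≤ ∑ a ∈ t, w a * y a ^ 2 := by
  have key := Finset.sum_sq_le_sum_mul_sum_of_sq_le_mul t (r := fun a => w a * y a)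
    (f := w) (g := fun a => w a * y a ^ 2) hw
    (fun a ha => mul_nonneg (hw a ha) (sq_nonneg _)) (fun a _ => le_of_eq (by ring))
  rwa [hw1, one_mul] at key


/-- The exact covariance matrix of a multinomially sampled batch,
`Σ_n = diag(π_a s_a²/b) + (1/(bn)) diag(π_a h_a²) − (1/(bn)) (π⊙h)(π⊙h)ᵀ`,
is symmetric positive definite, with `λ_max(Σ_n) ≤ max_a (s_a² + h_a²)/b` and
`λ_min(Σ_n) ≥ (min_a π_a)(min_a s_a²)/b`. -/
theorem stmt18 (K : ℕ) (hK : 0 < K)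
    (π h : Fin K → ℝ) (hπ0 : ∀ a, 0 < π a) (hπ1 : ∑ a, π a = 1)
    (s : Fin K → ℝ) (hs : ∀ a, 0 < s a)
    (b : ℝ) (hb : 0 < b) (n : ℕ) (hn : 1 ≤ n)
    (Sn : Matrix (Fin K) (Fin K) ℝ)
    (hSn : Sn = Matrix.diagonal (fun a => π a * (s a) ^ 2 / b)
        + (1 / (b * n)) • Matrix.diagonal (fun a => π a * (h a) ^ 2)
        - (1 / (b * n)) • Matrix.vecMulVec (fun a => π a * h a) (fun a => π a * h a)) :
    ∃ hH : Sn.IsHermitian,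
      Sn.PosDef ∧
      (∀ i, hH.eigenvalues i ≤ ⨆ a, ((s a) ^ 2 + (h a) ^ 2) / b) ∧
      (∀ i, (⨅ a, π a) * (⨅ a, (s a) ^ 2) / b ≤ hH.eigenvalues i) := by
  have : Nonempty (Fin K) := ⟨⟨0, hK⟩⟩
  have hn1 : (1 : ℝ) ≤ n := by exact_mod_cast hn
  have hc0 : 0 ≤ 1 / (b * n) := by positivity
  have hcb : 1 / (b * n) ≤ 1 / b := one_div_le_one_div_of_le hb (by nlinarith)
  have hH : Sn.IsHermitian := by
    rw [hSn]
    ext i j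
    simp [Matrix.vecMulVec_apply, Matrix.diagonal_apply, eq_comm (a := j) (b := i)]
    split_ifs with hij
    · subst hij; ring
    · ring
  have hquad (x : Fin K → ℝ) : x ⬝ᵥ Sn.mulVec x = ∑ a, π a * s a ^ 2 / b * x a ^ 2
      + 1 / (b * n) * (∑ a, π a * h a ^ 2 * x a ^ 2 - (∑ a, π a * h a * x a) ^ 2) := by
    rw [hSn, Matrix.sub_mulVec, Matrix.add_mulVec, Matrix.smul_mulVec, Matrix.smul_mulVec,
      dotProduct_sub, dotProduct_add, dotProduct_smul, dotProduct_smul,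
      Matrix.dotProduct_diagonal_mulVec, Matrix.dotProduct_diagonal_mulVec,
      Matrix.dotProduct_vecMulVec_mulVec, smul_eq_mul, smul_eq_mul]
    ring
  have hvar (x : Fin K → ℝ) :
      (∑ a, π a * h a * x a) ^ 2 ≤ ∑ a, π a * h a ^ 2 * x a ^ 2 := by
    simpa only [mul_pow, mul_assoc] using
      Finset.sq_sum_mul_le_sum_mul_sq (fun a _ => (hπ0 a).le) hπ1 (fun a => h a * x a)
  have hπmin : 0 < ⨅ a, π a := by
    obtain ⟨a, ha⟩ := exists_eq_ciInf_of_finite (f := π)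
    exact ha ▸ hπ0 a
  have hsmin : 0 < ⨅ a, s a ^ 2 := by
    obtain ⟨a, ha⟩ := exists_eq_ciInf_of_finite (f := fun a => s a ^ 2)
    exact ha ▸ pow_pos (hs a) 2
  have hlower (i : Fin K) : (⨅ a, π a) * (⨅ a, (s a) ^ 2) / b ≤ hH.eigenvalues i := by
    obtain ⟨v, hv, hev⟩ := hH.exists_eigenvalues_mul_dotProduct i
    refine le_of_mul_le_mul_right ?_ hv
    rw [← hev, hquad]
    refine le_add_of_le_of_nonneg ?_ (mul_nonneg hc0 (sub_nonneg.2 (hvar v)))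
    rw [dotProduct, Finset.mul_sum]
    refine Finset.sum_le_sum fun a _ => ?_
    have hπa : ⨅ a, π a ≤ π a := ciInf_le (Set.finite_range _).bddBelow a
    have hsa : ⨅ a, s a ^ 2 ≤ s a ^ 2 :=
      ciInf_le (f := fun a => s a ^ 2) (Set.finite_range _).bddBelow a
    rw [← sq]
    have := (hπ0 a).le
    gcongr
  have hupper (i : Fin K) : hH.eigenvalues i ≤ ⨆ a, ((s a) ^ 2 + (h a) ^ 2) / b := by
    obtain ⟨v, hv, hev⟩ := hH.exists_eigenvalues_mul_dotProduct i
    refine le_of_mul_le_mul_right ?_ hv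
    rw [← hev, hquad]
    have hcov : 1 / (b * n) * (∑ a, π a * h a ^ 2 * v a ^ 2 - (∑ a, π a * h a * v a) ^ 2)
        ≤ 1 / b * ∑ a, π a * h a ^ 2 * v a ^ 2 :=
      mul_le_mul hcb (sub_le_self _ (sq_nonneg _)) (sub_nonneg.2 (hvar v)) (by positivity)
    refine (add_le_add_right hcov _).trans ?_
    rw [dotProduct, Finset.mul_sum, Finset.mul_sum, ← Finset.sum_add_distrib]
    refine Finset.sum_le_sum fun a _ => ?_
    have hπa : π a ≤ 1 := hπ1 ▸ Finset.single_le_sum (fun c _ => (hπ0 c).le) (Finset.mem_univ a)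
    have hsup : (s a ^ 2 + h a ^ 2) / b ≤ ⨆ a, (s a ^ 2 + h a ^ 2) / b :=
      le_ciSup (f := fun a => (s a ^ 2 + h a ^ 2) / b) (Set.finite_range _).bddAbove a
    calc π a * s a ^ 2 / b * v a ^ 2 + 1 / b * (π a * h a ^ 2 * v a ^ 2)
        = π a * ((s a ^ 2 + h a ^ 2) / b * v a ^ 2) := by ring
      _ ≤ (s a ^ 2 + h a ^ 2) / b * v a ^ 2 := mul_le_of_le_one_left (by positivity) hπa
      _ ≤ (⨆ a, (s a ^ 2 + h a ^ 2) / b) * (v a * v a) := by rw [← sq]; gcongr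
  refine ⟨hH, hH.posDef_iff_eigenvalues_pos.2 fun i => ?_, hupper, hlower⟩
  exact (div_pos (mul_pos hπmin hsmin) hb).trans_le (hlower i)
end

section
/- Let π ∈ Δ_K with π_a > 0 for all a, h ∈ ℝ^K, s_a > 0, b > 0, and n ≥ 1. Define Σ = diag(π_a s_a² / b) and Σ_n = Σ + (1/(bn)) · diag(π_a h_a²) − (1/(bn)) · (π ⊙ h)(π ⊙ h)ᵀ, where (π ⊙ h)_a = π_a h_a. Then Σ_n is positive definite and tr(Σ⁻¹ Σ_n) − K + log det Σ − log det Σ_n ≤ (1/n) · [ (max_a h_a²/s_a²) / (1 − max_a h_a²/(s_a² + h_a²)) + Σ_a h_a²/s_a² ]. (The left-hand side equals twice the Kullback–Leibler divergence from the centered Gaussian with covariance Σ_n to the centered Gaussian with covariance Σ.) -/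
open Matrix in
theorem Matrix.det_diagonal_sub_smul_vecMulVec {ι F : Type*} [Fintype ι] [DecidableEq ι] [Field F]
    {d : ι → F} (hd : ∀ i, d i ≠ 0) (c : F) (u v : ι → F) :
    (diagonal d - c • vecMulVec u v).det = (∏ i, d i) * (1 - c * ∑ i, v i * u i / d i) := by
  have key : diagonal d - c • vecMulVec u v = diagonal d *
      (1 + replicateCol Unit (fun i => -c * u i / d i) * replicateRow Unit v) := by
    ext i j
    have hdi := hd i
    rw [Matrix.mul_add, Matrix.mul_one, Matrix.add_apply, diagonal_mul, Matrix.mul_apply]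
    simp only [sub_apply, smul_apply, vecMulVec_apply, smul_eq_mul, replicateCol_apply,
      replicateRow_apply, Finset.univ_unique, Finset.sum_singleton]
    field_simp
    ring
  rw [key, det_mul, det_diagonal, det_one_add_replicateCol_mul_replicateRow, dotProduct,
    sub_eq_add_neg, ← neg_mul, Finset.mul_sum]
  congr 2
  refine Finset.sum_congr rfl fun i _ => ?_
  ring

theorem sq_sum_mul_le_sum_mul_sq {ι : Type*} [Fintype ι] {p : ι → ℝ} (hp : ∀ i, 0 ≤ p i)
    (hp1 : ∑ i, p i = 1) (y : ι → ℝ) : (∑ i, p i * y i) ^ 2 ≤ ∑ i, p i * y i ^ 2 := by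
  have := Finset.sum_sq_le_sum_mul_sum_of_sq_le_mul Finset.univ (r := fun i => p i * y i)
    (f := p) (g := fun i => p i * y i ^ 2) (fun i _ => hp i)
    (fun i _ => mul_nonneg (hp i) (sq_nonneg _)) (fun i _ => le_of_eq (by ring))
  rwa [hp1, one_mul] at this

open Matrix in
theorem Matrix.posSemidef_diagonal_sub_vecMulVec {ι : Type*} [Fintype ι] [DecidableEq ι]
    {p : ι → ℝ} (hp : ∀ i, 0 ≤ p i) (hp1 : ∑ i, p i = 1) (y : ι → ℝ) :
    (diagonal (fun i => p i * y i ^ 2) -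
      vecMulVec (fun i => p i * y i) (fun i => p i * y i)).PosSemidef := by
  refine .of_dotProduct_mulVec_nonneg ?_ fun x => ?_
  · ext i j
    by_cases hij : i = j
    · subst hij
      simp
    · simp [diagonal_apply_ne _ hij, diagonal_apply_ne _ (Ne.symm hij), vecMulVec_apply, mul_comm]
  · have h := sq_sum_mul_le_sum_mul_sq hp hp1 fun i => y i * x i
    rw [sub_mulVec, dotProduct_sub, vecMulVec_mulVec]
    have h1 : star x ⬝ᵥ (diagonal (fun i => p i * y i ^ 2) *ᵥ x)
        = ∑ i, p i * (y i * x i) ^ 2 := by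
      simp only [dotProduct, mulVec_diagonal, star_trivial]
      exact Finset.sum_congr rfl fun i _ => by ring
    have h2 : (fun i => p i * y i) ⬝ᵥ x = ∑ i, p i * (y i * x i) := by
      simp only [dotProduct, mul_assoc]
    have h3 : star x ⬝ᵥ (fun i => p i * y i) = ∑ i, p i * (y i * x i) := by
      simp only [dotProduct, star_trivial]
      exact Finset.sum_congr rfl fun i _ => by ring
    rw [h1, h2, op_smul_eq_smul, dotProduct_smul, h3, smul_eq_mul]
    linarith

theorem sum_mul_le_of_forall_le {ι : Type*} [Fintype ι] {p : ι → ℝ} (hp : ∀ i, 0 ≤ p i)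
    (hp1 : ∑ i, p i = 1) {y : ι → ℝ} {M : ℝ} (hy : ∀ i, y i ≤ M) : ∑ i, p i * y i ≤ M :=
  calc ∑ i, p i * y i ≤ ∑ i, p i * M :=
        Finset.sum_le_sum fun i _ => mul_le_mul_of_nonneg_left (hy i) (hp i)
    _ = M := by rw [← Finset.sum_mul, hp1, one_mul]


/-- KL-divergence bound between the pre-limit batch covariance
`Σ_n = Σ + (1/(bn)) diag(π_a h_a²) − (1/(bn)) (π⊙h)(π⊙h)ᵀ` and its Gaussian limit
`Σ = diag(π_a s_a²/b)`: `Σ_n` is positive definite and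
`tr(Σ⁻¹ Σ_n) − K + log det Σ − log det Σ_n
  ≤ (1/n) [ (max_a h_a²/s_a²)/(1 − max_a h_a²/(s_a² + h_a²)) + Σ_a h_a²/s_a² ]`
(the left-hand side is twice the KL divergence from `N(0, Σ_n)` to `N(0, Σ)`). -/
theorem stmt19 (K : ℕ) (hK : 0 < K)
    (π h : Fin K → ℝ) (hπ0 : ∀ a, 0 < π a) (hπ1 : ∑ a, π a = 1)
    (s : Fin K → ℝ) (hs : ∀ a, 0 < s a)
    (b : ℝ) (hb : 0 < b) (n : ℕ) (hn : 1 ≤ n)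
    (S : Matrix (Fin K) (Fin K) ℝ)
    (hS : S = Matrix.diagonal (fun a => π a * (s a) ^ 2 / b))
    (Sn : Matrix (Fin K) (Fin K) ℝ)
    (hSn : Sn = S + (1 / (b * n)) • Matrix.diagonal (fun a => π a * (h a) ^ 2)
        - (1 / (b * n)) • Matrix.vecMulVec (fun a => π a * h a) (fun a => π a * h a)) :
    Sn.PosDef ∧
      (S⁻¹ * Sn).trace - K + Real.log S.det - Real.log Sn.det
        ≤ (1 / n) *
            ((⨆ a, (h a) ^ 2 / (s a) ^ 2)
                / (1 - ⨆ a, (h a) ^ 2 / ((s a) ^ 2 + (h a) ^ 2))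
              + ∑ a, (h a) ^ 2 / (s a) ^ 2) := by
  have : Nonempty (Fin K) := ⟨⟨0, hK⟩⟩
  have hn1 : (1 : ℝ) ≤ n := by exact_mod_cast hn
  have hn0 : (0 : ℝ) < n := by linarith
  have hs2 (a) : 0 < s a ^ 2 := pow_pos (hs a) 2
  have hπn (a) : 0 ≤ π a := (hπ0 a).le
  have hSpos (a) : 0 < π a * s a ^ 2 / b := div_pos (mul_pos (hπ0 a) (hs2 a)) hb
  have hSn' : Sn = Matrix.diagonal (fun a => π a * (s a ^ 2 + h a ^ 2 / n) / b) -
      (1 / (b * n)) • Matrix.vecMulVec (fun a => π a * h a) (fun a => π a * h a) := by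
    rw [hSn, hS, ← Matrix.diagonal_smul, Matrix.diagonal_add]
    congr 2
    funext a
    simp only [Pi.smul_apply, smul_eq_mul]
    field_simp
  have hpos : Sn.PosDef := by
    rw [hSn, add_sub_assoc, ← smul_sub, hS]
    exact (Matrix.PosDef.diagonal hSpos).add_posSemidef
      ((Matrix.posSemidef_diagonal_sub_vecMulVec hπn hπ1 h).smul (by positivity))
  refine ⟨hpos, ?_⟩
  have hd (a) : 0 < π a * (s a ^ 2 + h a ^ 2 / n) / b :=
    div_pos (mul_pos (hπ0 a) (add_pos_of_pos_of_nonneg (hs2 a) (by positivity))) hb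
  set X := ⨆ a, h a ^ 2 / s a ^ 2 with hX
  set M := ⨆ a, h a ^ 2 / (s a ^ 2 + h a ^ 2) with hM
  have hleX (a) : h a ^ 2 / s a ^ 2 ≤ X :=
    le_ciSup (f := fun a => h a ^ 2 / s a ^ 2) (Set.finite_range _).bddAbove a
  have hleM (a) : h a ^ 2 / (s a ^ 2 + h a ^ 2) ≤ M :=
    le_ciSup (f := fun a => h a ^ 2 / (s a ^ 2 + h a ^ 2)) (Set.finite_range _).bddAbove a
  have hM1 : M < 1 := by
    obtain ⟨a, ha⟩ := exists_eq_ciSup_of_finite (f := fun a => h a ^ 2 / (s a ^ 2 + h a ^ 2))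
    rw [hM, ← ha, div_lt_one (add_pos_of_pos_of_nonneg (hs2 a) (sq_nonneg _))]
    linarith [hs2 a]
  set q := ∑ a, π a * (h a ^ 2 / (n * s a ^ 2 + h a ^ 2)) with hq
  have hq0 : 0 ≤ q := Finset.sum_nonneg fun a _ => mul_nonneg (hπn a) (by positivity)
  have hqX : q ≤ X / n := sum_mul_le_of_forall_le hπn hπ1 fun a => by
    refine le_trans ?_ (div_le_div_of_nonneg_right (hleX a) hn0.le)
    rw [div_div]
    exact div_le_div_of_nonneg_left (sq_nonneg _) (mul_pos (hs2 a) hn0)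
      (by nlinarith [sq_nonneg (h a)])
  have hqM : q ≤ M := sum_mul_le_of_forall_le hπn hπ1 fun a => by
    refine le_trans ?_ (hleM a)
    exact div_le_div_of_nonneg_left (sq_nonneg _)
      (add_pos_of_pos_of_nonneg (hs2 a) (sq_nonneg _)) (by nlinarith [hs2 a])
  have hdetSn : Sn.det = (∏ a, π a * (s a ^ 2 + h a ^ 2 / n) / b) * (1 - q) := by
    rw [hSn', Matrix.det_diagonal_sub_smul_vecMulVec (fun a => (hd a).ne'), Finset.mul_sum]
    congr 2
    refine Finset.sum_congr rfl fun a _ => ?_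
    have := hs2 a
    have := hπ0 a
    have : 0 < n * s a ^ 2 + h a ^ 2 := by positivity
    have : 0 < s a ^ 2 + h a ^ 2 / n := by positivity
    field_simp
  have hdetS : S.det ≤ ∏ a, π a * (s a ^ 2 + h a ^ 2 / n) / b := by
    rw [hS, Matrix.det_diagonal]
    refine Finset.prod_le_prod (fun a _ => (hSpos a).le) fun a _ => ?_
    have : 0 ≤ h a ^ 2 / n := by positivity
    exact div_le_div_of_nonneg_right (mul_le_mul_of_nonneg_left (by linarith) (hπn a)) hb.le
  have hdetS0 : 0 < S.det := by
    rw [hS, Matrix.det_diagonal]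
    exact Finset.prod_pos fun a _ => hSpos a
  have hlog : Real.log S.det - Real.log Sn.det ≤ X / n / (1 - M) := by
    have h1 : 0 < 1 - q := by linarith
    rw [hdetSn, Real.log_mul (hdetS0.trans_le hdetS).ne' h1.ne']
    have h2 := Real.log_le_log hdetS0 hdetS
    have h3 := Real.one_sub_inv_le_log_of_pos h1
    have h4 : (1 - q)⁻¹ - 1 = q / (1 - q) := by
      field_simp
      ring
    have h5 : q / (1 - q) ≤ X / n / (1 - M) :=
      div_le_div₀ (hq0.trans hqX) hqX (by linarith) (by linarith)
    linarith
  have htrace : (S⁻¹ * Sn).trace - K ≤ (1 / n) * ∑ a, h a ^ 2 / s a ^ 2 := by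
    have hinv : S⁻¹ = Matrix.diagonal fun a => (π a * s a ^ 2 / b)⁻¹ := by
      refine Matrix.inv_eq_left_inv ?_
      rw [hS, Matrix.diagonal_mul_diagonal, ← Matrix.diagonal_one]
      congr 1
      funext a
      exact inv_mul_cancel₀ (hSpos a).ne'
    have hK1 : (K : ℝ) = ∑ _a : Fin K, 1 := by simp
    rw [Matrix.trace, hK1, ← Finset.sum_sub_distrib, Finset.mul_sum]
    refine Finset.sum_le_sum fun a _ => ?_
    rw [Matrix.diag_apply, hinv, Matrix.diagonal_mul, hSn']
    simp only [Matrix.sub_apply, Matrix.diagonal_apply_eq, Matrix.smul_apply,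
      Matrix.vecMulVec_apply, smul_eq_mul]
    have := hs2 a
    have := hπ0 a
    have h1 : (π a * s a ^ 2 / b)⁻¹ * (π a * (s a ^ 2 + h a ^ 2 / n) / b -
        1 / (b * n) * (π a * h a * (π a * h a))) - 1
        = 1 / n * (h a ^ 2 / s a ^ 2) - π a * h a ^ 2 / (n * s a ^ 2) := by
      have := hs a
      field_simp
      ring
    have h2 : 0 ≤ π a * h a ^ 2 / (n * s a ^ 2) := by positivity
    linarith
  have hX1 : 1 / n * (X / (1 - M)) = X / n / (1 - M) := by ring
  rw [mul_add, hX1]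
  linarith
end
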